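/- Under the stated assumptions, the fourth-order exponential moment (Lyapunov) condition holds: for every δ > 0, limsup_n b_n^{−2} log P( b_n² Σ_{i∈G_{n−p_n}} E[Δ_{n,i}(𝔣_n)⁴ | F_i] > δ ) = −∞. -/

import Mathlib

open MeasureTheory Filter ProbabilityTheory

noncomputable section

namespace BMC

/-- A vertex of the infinite binary tree is a finite word over `{0,1}`. -/
abbrev Word : Type := List Bool

/-- The `k`-th generation `G_k` of the binary tree. -/
def gen (k : ℕ) : Finset Word :=
  (Finset.univ : Finset (Fin k → Bool)).image fun f => List.ofFn f

/-- The tree `T_k` up to generation `k`. -/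
def tree (k : ℕ) : Finset Word := (Finset.range (k + 1)).biUnion gen

/-- The (lexicographic-genealogic) order on the binary tree: `i ≤ j` iff `i` is an
ancestor of `j`, or `v0` is an ancestor of `i` and `v1` an ancestor of `j` for some `v`. -/
def wle (i j : Word) : Prop :=
  i <+: j ∨ ∃ v : Word, (v ++ [false]) <+: i ∧ (v ++ [true]) <+: j

variable {d : ℕ}

/-- Euclidean norm on `Fin d → ℝ`. -/
def enorm (x : Fin d → ℝ) : ℝ := Real.sqrt (∑ j, x j ^ 2)

/-- Action of the kernel `P` on a function of the pair of children. -/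
def Pop (P : Kernel (Fin d → ℝ) ((Fin d → ℝ) × (Fin d → ℝ)))
    (h : (Fin d → ℝ) × (Fin d → ℝ) → ℝ) (x : Fin d → ℝ) : ℝ := ∫ p, h p ∂(P x)

/-- The mean kernel `Q = (P₀ + P₁)/2`, acting on functions. -/
def Qop (P : Kernel (Fin d → ℝ) ((Fin d → ℝ) × (Fin d → ℝ)))
    (f : (Fin d → ℝ) → ℝ) : (Fin d → ℝ) → ℝ :=
  fun x => (∫ p, (f p.1 + f p.2) ∂(P x)) / 2

/-- The σ-field generated by the chain up to generation `k`. -/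
def sigmaUpTo {Ω : Type*} [MeasurableSpace Ω] (X : Word → Ω → (Fin d → ℝ)) (k : ℕ) :
    MeasurableSpace Ω :=
  ⨆ j ∈ tree k, MeasurableSpace.comap (X j) inferInstance

/-- The σ-field `F_i` generated by `X_u` for `u ≤ i` in the tree order. -/
def Fsig {Ω : Type*} [MeasurableSpace Ω] (X : Word → Ω → (Fin d → ℝ)) (i : Word) :
    MeasurableSpace Ω :=
  ⨆ u ∈ {u : Word | wle u i}, MeasurableSpace.comap (X u) inferInstance

/-- `X` is a bifurcating Markov chain with initial distribution `ν` and kernel `P`. -/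
structure IsBMC {Ω : Type*} [MeasurableSpace Ω] (Pr : Measure Ω)
    (X : Word → Ω → (Fin d → ℝ)) (ν : Measure (Fin d → ℝ))
    (P : Kernel (Fin d → ℝ) ((Fin d → ℝ) × (Fin d → ℝ))) : Prop where
  meas : ∀ i, Measurable (X i)
  init : Pr.map (X []) = ν
  branching : ∀ (k : ℕ) (g : Word → (Fin d → ℝ) → (Fin d → ℝ) → (Fin d → ℝ) → ℝ),
    (∀ i, Measurable fun p : (Fin d → ℝ) × (Fin d → ℝ) × (Fin d → ℝ) => g i p.1 p.2.1 p.2.2) →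
    (∀ i, ∃ C, ∀ x y z, |g i x y z| ≤ C) →
    (Pr[(fun ω => ∏ i ∈ gen k, g i (X i ω) (X (i ++ [false]) ω) (X (i ++ [true]) ω))
        | sigmaUpTo X k]
      =ᵐ[Pr] fun ω => ∏ i ∈ gen k, ∫ p, g i (X i ω) p.1 p.2 ∂(P (X i ω)))

/-- Uniform geometric ergodicity of `Q` with invariant measure `μm`, rate `α`, constant `M`. -/
def ErgodicQ (P : Kernel (Fin d → ℝ) ((Fin d → ℝ) × (Fin d → ℝ)))
    (μm : Measure (Fin d → ℝ)) (M α : ℝ) : Prop :=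
  ∀ (f : (Fin d → ℝ) → ℝ) (C : ℝ), Measurable f → (∀ x, |f x| ≤ C) →
    ∀ (n : ℕ) (x : Fin d → ℝ), |(Qop P)^[n] f x - ∫ y, f y ∂μm| ≤ M * α ^ n * C

/-- `μm` is invariant for `Q`. -/
def IsInvariantQ (P : Kernel (Fin d → ℝ) ((Fin d → ℝ) × (Fin d → ℝ)))
    (μm : Measure (Fin d → ℝ)) : Prop :=
  ∀ f : (Fin d → ℝ) → ℝ, Measurable f → (∃ C, ∀ x, |f x| ≤ C) →
    ∫ x, Qop P f x ∂μm = ∫ x, f x ∂μm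

/-- The bandwidth `h_n = 2^{-nγ}`. -/
def bandwidth (γ : ℝ) (n : ℕ) : ℝ := (2 : ℝ) ^ (-(n : ℝ) * γ)

/-- The kernel density estimator `μ̂_{A}(x)` built from observations indexed by `A`. -/
def est {Ω : Type*} (K : (Fin d → ℝ) → ℝ) (X : Word → Ω → (Fin d → ℝ)) (γ : ℝ)
    (A : Finset Word) (n : ℕ) (x : Fin d → ℝ) (ω : Ω) : ℝ :=
  (A.card : ℝ)⁻¹ * (bandwidth γ n ^ (d : ℝ))⁻¹ *
    ∑ u ∈ A, K ((bandwidth γ n)⁻¹ • (x - X u ω))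

/-- One-dimensional `k`-th partial derivative of `f` in direction `j` at `x`. -/
def pder (f : (Fin d → ℝ) → ℝ) (j : Fin d) (k : ℕ) (x : Fin d → ℝ) : ℝ :=
  iteratedDeriv k (fun t => f (Function.update x j t)) (x j)

/-- `f` belongs to the isotropic Hölder class of order `s` with constant `L`. -/
def HolderClass (f : (Fin d → ℝ) → ℝ) (s L : ℝ) : Prop :=
  (∀ (j : Fin d) (x : Fin d → ℝ),
      ContDiff ℝ (⌊s⌋₊ : ℕ∞) fun t => f (Function.update x j t)) ∧
  ∀ (j : Fin d) (x : Fin d → ℝ) (t : ℝ),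
    |pder f j ⌊s⌋₊ (Function.update x j t) - pder f j ⌊s⌋₊ x| ≤
      L * |x j - t| ^ (s - (⌊s⌋₊ : ℝ))

/-- Regularity of the kernel function `K`. -/
def KernelReg (K : (Fin d → ℝ) → ℝ) : Prop :=
  Measurable K ∧ (∃ C, ∀ x, |K x| ≤ C) ∧ Integrable K volume ∧
    Integrable (fun x => K x ^ 2) volume ∧ (∫ x, K x) = 1 ∧
    ∀ ε > 0, ∃ R, ∀ x, R ≤ enorm x → |enorm x * K x| < ε

/-- `K` is of order `⌊s⌋`. -/
def KernelOrder (K : (Fin d → ℝ) → ℝ) (s : ℝ) : Prop :=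
  Integrable (fun x => enorm x ^ s * |K x|) volume ∧
    ∀ (j : Fin d) (k : ℕ), 1 ≤ k → k ≤ ⌊s⌋₊ →
      ∀ x : Fin d → ℝ, (∫ t : ℝ, t ^ k * K (Function.update x j t)) = 0

/-- Conditions (2.7) on the moderate deviation speed `b_n`. -/
def SpeedCond (b : ℕ → ℝ) (γ s : ℝ) (d : ℕ) : Prop :=
  (∀ n, 0 < b n) ∧ Tendsto b atTop atTop ∧
    Tendsto (fun n : ℕ => (n : ℝ) ^ (3 / 2 : ℝ) * b n /
      Real.sqrt (2 ^ n * bandwidth γ n ^ (d : ℝ))) atTop (nhds 0) ∧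
    Tendsto (fun n => b n /
      Real.sqrt (2 ^ n * bandwidth γ n ^ (2 * s + d))) atTop atTop

/-- `W` satisfies a moderate deviation principle with speed `b_n²` and rate function `I`. -/
def MDPseq {E Ω : Type*} [TopologicalSpace E] [MeasurableSpace E] [MeasurableSpace Ω]
    (Pr : Measure Ω) (W : ℕ → Ω → E) (b : ℕ → ℝ) (I : E → ℝ) : Prop :=
  ∀ A : Set E, MeasurableSet A →
    (-(⨅ y ∈ interior A, (I y : EReal)) ≤
      Filter.liminf
        (fun n => (((b n ^ 2)⁻¹ : ℝ) : EReal) * ENNReal.log (Pr {ω | W n ω ∈ A})) atTop) ∧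
    Filter.limsup
        (fun n => (((b n ^ 2)⁻¹ : ℝ) : EReal) * ENNReal.log (Pr {ω | W n ω ∈ A})) atTop ≤
      -(⨅ y ∈ closure A, (I y : EReal))

/-- `f` centered with respect to `μm`. -/
def tilde (μm : Measure (Fin d → ℝ)) (f : (Fin d → ℝ) → ℝ) (x : Fin d → ℝ) : ℝ :=
  f x - ∫ y, f y ∂μm

/-- `M_A(f) = Σ_{i ∈ A} f(X_i)`. -/
def MA {Ω : Type*} (X : Word → Ω → (Fin d → ℝ)) (A : Finset Word)
    (f : (Fin d → ℝ) → ℝ) (ω : Ω) : ℝ :=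
  ∑ i ∈ A, f (X i ω)

/-- Assumption 2.4 on the sequence of functions `𝔣_n = (f_{ℓ,n})`, where `f n ℓ = f_{ℓ,n}`. -/
def FnAssump (P : Kernel (Fin d → ℝ) ((Fin d → ℝ) × (Fin d → ℝ)))
    (μm : Measure (Fin d → ℝ)) (γ : ℝ) (f : ℕ → ℕ → (Fin d → ℝ) → ℝ) (σ2 : ℝ) : Prop :=
  (∀ n ℓ, Measurable (f n ℓ)) ∧
  (∀ n ℓ, n < ℓ → f n ℓ = 0) ∧
  (∃ C : ℝ, ∀ n : ℕ, ∀ ℓ ≤ n,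
    (∀ x, bandwidth γ n ^ ((d : ℝ) / 2) * |f n ℓ x| ≤ C) ∧
    (∀ x, |Qop P (f n ℓ) x| ≤ C * bandwidth γ n ^ ((d : ℝ) / 2)) ∧
    (∀ x, |Qop P (fun y => f n ℓ y ^ 2) x| ≤ C) ∧
    (∀ x, |Pop P (fun q => f n ℓ q.1 * f n ℓ q.2) x| ≤ C * bandwidth γ n ^ (d : ℝ))) ∧
  (∃ C : ℝ, ∀ n : ℕ, ∀ ℓ ≤ n,
    (∫ x, |f n ℓ x| ∂μm) ≤ C * bandwidth γ n ^ ((d : ℝ) / 2) ∧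
    (∫ x, f n ℓ x ^ 2 ∂μm) ≤ C) ∧
  Tendsto (fun n => ∑ ℓ ∈ Finset.range (n + 1), ((2 : ℝ)⁻¹) ^ ℓ * ∫ x, f n ℓ x ^ 2 ∂μm)
    atTop (nhds σ2)

/-- `N_{n,∅}(𝔣_n)`. -/
def Nempty {Ω : Type*} (X : Word → Ω → (Fin d → ℝ)) (μm : Measure (Fin d → ℝ))
    (f : ℕ → ℕ → (Fin d → ℝ) → ℝ) (n : ℕ) (ω : Ω) : ℝ :=
  (Real.sqrt (2 ^ n))⁻¹ * ∑ ℓ ∈ Finset.range (n + 1), MA X (gen (n - ℓ)) (tilde μm (f n ℓ)) ω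

/-- Conditions on the auxiliary sequence `p_n`. -/
def PCond (p : ℕ → ℕ) (b : ℕ → ℝ) : Prop :=
  Monotone p ∧ (∀ n, 1 ≤ p n) ∧ (∀ n, 1 ≤ n → p n ≤ n) ∧
    Tendsto (fun n => (p n : ℝ) ^ 3 * b n ^ 2 / 2 ^ (n - p n : ℕ)) atTop (nhds 0)

/-- `N_{n,i}(𝔣_n)` for `i ∈ G_{n-p_n}`. -/
def Nni {Ω : Type*} (X : Word → Ω → (Fin d → ℝ)) (μm : Measure (Fin d → ℝ))
    (f : ℕ → ℕ → (Fin d → ℝ) → ℝ) (p : ℕ → ℕ) (n : ℕ) (i : Word) (ω : Ω) : ℝ :=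
  (Real.sqrt (2 ^ n))⁻¹ * ∑ ℓ ∈ Finset.range (p n + 1),
    ∑ j ∈ gen (p n - ℓ), tilde μm (f n ℓ) (X (i ++ j) ω)

/-- The martingale increment `Δ_{n,i}(𝔣_n)`. -/
def Dni {Ω : Type*} [MeasurableSpace Ω] (Pr : Measure Ω) (X : Word → Ω → (Fin d → ℝ))
    (μm : Measure (Fin d → ℝ)) (f : ℕ → ℕ → (Fin d → ℝ) → ℝ) (p : ℕ → ℕ)
    (n : ℕ) (i : Word) (ω : Ω) : ℝ :=
  Nni X μm f p n i ω - (Pr[Nni X μm f p n i | Fsig X i]) ω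

lemma mem_gen {k : ℕ} {w : Word} : w ∈ gen k ↔ w.length = k := by
  constructor
  · intro h
    obtain ⟨f, -, rfl⟩ := Finset.mem_image.1 h
    simp
  · rintro rfl
    exact Finset.mem_image.2 ⟨w.get, Finset.mem_univ _, List.ofFn_get w⟩

lemma mem_tree {k : ℕ} {w : Word} : w ∈ tree k ↔ w.length ≤ k := by
  simp [tree, mem_gen]

lemma card_gen (k : ℕ) : (gen k).card = 2 ^ k := by
  rw [gen, Finset.card_image_of_injective _ List.ofFn_injective]
  simp

lemma gen_zero : gen 0 = {[]} := by
  ext w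
  simp [mem_gen]

lemma gen_succ_append (k : ℕ) :
    gen (k + 1) = (gen k).biUnion fun w => {w ++ [false], w ++ [true]} := by
  ext w
  simp only [mem_gen, Finset.mem_biUnion, Finset.mem_insert, Finset.mem_singleton]
  constructor
  · intro h
    have hw : w ≠ [] := by rintro rfl; simp at h
    refine ⟨w.dropLast, by simp [h], ?_⟩
    have h1 := List.dropLast_append_getLast hw
    cases hb : w.getLast hw <;> rw [hb] at h1 <;> simp [h1]
  · rintro ⟨v, hv, rfl | rfl⟩ <;> simp [hv]

lemma gen_succ_cons (k : ℕ) :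
    gen (k + 1) = (gen k).image (List.cons false) ∪ (gen k).image (List.cons true) := by
  ext w
  simp only [mem_gen, Finset.mem_union, Finset.mem_image]
  constructor
  · intro h
    rcases w with _ | ⟨c, v⟩
    · simp at h
    · cases c
      · exact Or.inl ⟨v, by simpa using h, rfl⟩
      · exact Or.inr ⟨v, by simpa using h, rfl⟩
  · rintro (⟨v, hv, rfl⟩ | ⟨v, hv, rfl⟩) <;> simp [hv]

lemma prod_gen_succ (k : ℕ) (F : Word → ℝ) :
    ∏ u ∈ gen (k + 1), F u = ∏ w ∈ gen k, F (w ++ [false]) * F (w ++ [true]) := by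
  rw [gen_succ_append, Finset.prod_biUnion]
  · refine Finset.prod_congr rfl fun w _ => ?_
    rw [Finset.prod_pair (by simp)]
  · intro v _ w _ hvw
    rw [Function.onFun, Finset.disjoint_left]
    intro u hu hu'
    simp only [Finset.mem_insert, Finset.mem_singleton] at hu hu'
    apply hvw
    rcases hu with rfl | rfl <;> rcases hu' with h | h <;>
      exact (List.append_inj' h rfl).1

lemma sum_gen_succ (k : ℕ) (F : Word → ℝ) :
    ∑ u ∈ gen (k + 1), F u = ∑ u ∈ gen k, F (false :: u) + ∑ u ∈ gen k, F (true :: u) := by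
  rw [gen_succ_cons, Finset.sum_union, Finset.sum_image, Finset.sum_image]
  · intro u _ v _ h; simpa using h
  · intro u _ v _ h; simpa using h
  · rw [Finset.disjoint_left]
    intro u hu hu'
    obtain ⟨v, -, rfl⟩ := Finset.mem_image.1 hu
    obtain ⟨w, -, h⟩ := Finset.mem_image.1 hu'
    simp at h

lemma prod_tree_succ (k : ℕ) (F : Word → ℝ) :
    ∏ u ∈ tree (k + 1), F u = (∏ u ∈ tree k, F u) * ∏ u ∈ gen (k + 1), F u := by
  rw [← Finset.prod_union]
  · congr 1
    ext w
    simp only [mem_tree, Finset.mem_union, mem_gen]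
    omega
  · rw [Finset.disjoint_left]
    intro u hu hu'
    rw [mem_tree] at hu
    rw [mem_gen] at hu'
    omega

section Markov

variable {Ω : Type*} [MeasurableSpace Ω]

/-- The σ-field generated by the values at all vertices that are not strict descendants of `i`. -/
@[reducible] def sigmaOutside (X : Word → Ω → (Fin d → ℝ)) (i : Word) : MeasurableSpace Ω :=
  ⨆ u ∈ {u : Word | i <+: u → u = i}, MeasurableSpace.comap (X u) inferInstance

lemma sigmaUpTo_le {X : Word → Ω → (Fin d → ℝ)} (hX : ∀ i, Measurable (X i)) (k : ℕ) :
    sigmaUpTo X k ≤ ‹MeasurableSpace Ω› :=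
  iSup₂_le fun u _ => (hX u).comap_le

lemma sigmaOutside_le {X : Word → Ω → (Fin d → ℝ)} (hX : ∀ i, Measurable (X i)) (i : Word) :
    sigmaOutside X i ≤ ‹MeasurableSpace Ω› :=
  iSup₂_le fun u _ => (hX u).comap_le

lemma Fsig_le {X : Word → Ω → (Fin d → ℝ)} (hX : ∀ i, Measurable (X i)) (i : Word) :
    Fsig X i ≤ ‹MeasurableSpace Ω› :=
  iSup₂_le fun u _ => (hX u).comap_le

lemma measurable_sigmaUpTo (X : Word → Ω → (Fin d → ℝ)) {k : ℕ} {u : Word} (hu : u.length ≤ k) :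
    Measurable[sigmaUpTo X k] (X u) :=
  (comap_measurable (X u)).mono
    (le_iSup₂_of_le (f := fun j _ => MeasurableSpace.comap (X j) inferInstance)
      u (mem_tree.2 hu) le_rfl) le_rfl

omit [MeasurableSpace Ω] in
lemma measurable_sigmaOutside (X : Word → Ω → (Fin d → ℝ)) {i u : Word} (hu : i <+: u → u = i) :
    Measurable[sigmaOutside X i] (X u) :=
  (comap_measurable (X u)).mono
    (le_iSup₂_of_le (f := fun j _ => MeasurableSpace.comap (X j) inferInstance)
      u hu le_rfl) le_rfl

lemma measurable_Fsig (X : Word → Ω → (Fin d → ℝ)) {i u : Word} (hu : wle u i) :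
    Measurable[Fsig X i] (X u) :=
  (comap_measurable (X u)).mono
    (le_iSup₂_of_le (f := fun j _ => MeasurableSpace.comap (X j) inferInstance)
      u hu le_rfl) le_rfl

omit [MeasurableSpace Ω] in
lemma sigmaOutside_mono (X : Word → Ω → (Fin d → ℝ)) {i j : Word} (hij : i <+: j) :
    sigmaOutside X i ≤ sigmaOutside X j := by
  refine iSup₂_le fun u hu => ?_
  refine (measurable_sigmaOutside X fun hju => ?_).comap_le
  have h1 := hu (hij.trans hju)
  subst h1
  exact (hju.eq_of_length (le_antisymm hju.length_le hij.length_le)).symm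

lemma Fsig_le_sigmaOutside (X : Word → Ω → (Fin d → ℝ)) (i : Word) :
    Fsig X i ≤ sigmaOutside X i := by
  refine iSup₂_le fun u hu => ?_
  refine (measurable_sigmaOutside X fun hiu => ?_).comap_le
  rcases hu with h | ⟨v, h1, h2⟩
  · exact h.eq_of_length (le_antisymm h.length_le hiu.length_le)
  · exfalso
    have h3 := List.prefix_of_prefix_length_le h1 (h2.trans hiu) (by simp)
    have h4 := h3.eq_of_length (by simp)
    simp at h4

lemma measurable_integral_kernel
    (P : Kernel (Fin d → ℝ) ((Fin d → ℝ) × (Fin d → ℝ))) [IsMarkovKernel P]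
    {g : (Fin d → ℝ) × (Fin d → ℝ) → ℝ} (hg : Measurable g) :
    Measurable fun x => ∫ q, g q ∂(P x) :=
  (hg.stronglyMeasurable.integral_kernel (κ := P)).measurable

lemma integrable_of_bound {α : Type*} [MeasurableSpace α] {m : Measure α} [IsFiniteMeasure m]
    {g : α → ℝ} (hg : Measurable g) {C : ℝ} (hC : ∀ x, |g x| ≤ C) : Integrable g m :=
  Integrable.of_bound hg.aestronglyMeasurable C (Eventually.of_forall hC)

lemma abs_integral_le_of_bound {α : Type*} [MeasurableSpace α] {m : Measure α}
    [IsProbabilityMeasure m] {g : α → ℝ} {C : ℝ} (hC : ∀ x, |g x| ≤ C) : |∫ x, g x ∂m| ≤ C := by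
  have h := norm_integral_le_of_norm_le_const (μ := m) (f := g) (C := C) (Eventually.of_forall hC)
  simpa using h

lemma exists_bound_prod {α ι : Type*} (s : Finset ι) {g : ι → α → ℝ}
    (hg : ∀ i, ∃ C, ∀ x, |g i x| ≤ C) : ∃ C, ∀ x, |∏ i ∈ s, g i x| ≤ C := by
  choose C hC using hg
  refine ⟨∏ i ∈ s, C i, fun x => ?_⟩
  rw [Finset.abs_prod]
  exact Finset.prod_le_prod (fun _ _ => abs_nonneg _) fun i _ => hC i x

lemma exists_bound_mul {α : Type*} {g h : α → ℝ} (hg : ∃ C, ∀ x, |g x| ≤ C)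
    (hh : ∃ C, ∀ x, |h x| ≤ C) : ∃ C, ∀ x, |g x * h x| ≤ C := by
  obtain ⟨C, hC⟩ := hg
  obtain ⟨D, hD⟩ := hh
  refine ⟨C * D, fun x => ?_⟩
  rw [abs_mul]
  exact mul_le_mul (hC x) (hD x) (abs_nonneg _) ((abs_nonneg _).trans (hC x))

variable {Pr : Measure Ω} [IsProbabilityMeasure Pr] {X : Word → Ω → (Fin d → ℝ)}
  {ν : Measure (Fin d → ℝ)} {P : Kernel (Fin d → ℝ) ((Fin d → ℝ) × (Fin d → ℝ))}
  [IsMarkovKernel P]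

omit [IsMarkovKernel P] in
/-- Integrated form of the branching property, for functions of the children. -/
lemma IsBMC.integral_mul_prod (hB : IsBMC Pr X ν P) (k : ℕ) {U : Ω → ℝ}
    (hU : Measurable[sigmaUpTo X k] U) (hUb : ∃ C, ∀ ω, |U ω| ≤ C)
    {g : Word → (Fin d → ℝ) × (Fin d → ℝ) → ℝ} (hg : ∀ w, Measurable (g w))
    (hgb : ∀ w, ∃ C, ∀ q, |g w q| ≤ C) :
    ∫ ω, U ω * ∏ w ∈ gen k, g w (X (w ++ [false]) ω, X (w ++ [true]) ω) ∂Pr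
      = ∫ ω, U ω * ∏ w ∈ gen k, Pop P (g w) (X w ω) ∂Pr := by
  have hle := sigmaUpTo_le hB.meas k
  have hbr := hB.branching k (fun w _ y z => g w (y, z))
    (fun w => (hg w).comp measurable_snd)
    (fun w => (hgb w).imp fun C hC _ y z => hC (y, z))
  set Z : Ω → ℝ := fun ω => ∏ w ∈ gen k, g w (X (w ++ [false]) ω, X (w ++ [true]) ω) with hZ
  have hZm : Measurable Z := Finset.measurable_prod _ fun w _ =>
    (hg w).comp ((hB.meas _).prodMk (hB.meas _))
  obtain ⟨C, hC⟩ : ∃ C, ∀ ω, |Z ω| ≤ C := exists_bound_prod _ fun w =>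
    (hgb w).imp fun C hC ω => hC _
  obtain ⟨D, hD⟩ := exists_bound_mul hUb ⟨C, hC⟩
  have hZi : Integrable Z Pr := integrable_of_bound hZm hC
  have hUZi : Integrable (U * Z) Pr := integrable_of_bound ((hU.mono hle le_rfl).mul hZm) hD
  have h1 := condExp_mul_of_stronglyMeasurable_left (μ := Pr) hU.stronglyMeasurable hUZi hZi
  calc ∫ ω, U ω * Z ω ∂Pr = ∫ ω, (Pr[U * Z | sigmaUpTo X k]) ω ∂Pr := (integral_condExp hle).symm
    _ = _ := by
      refine integral_congr_ae ?_
      filter_upwards [h1, hbr] with ω h1 h2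
      rw [h1, Pi.mul_apply, h2]
      rfl

lemma measurable_Pop {g : (Fin d → ℝ) × (Fin d → ℝ) → ℝ} (hg : Measurable g) :
    Measurable (Pop P g) := measurable_integral_kernel P hg

lemma abs_Pop_le {g : (Fin d → ℝ) × (Fin d → ℝ) → ℝ} {C : ℝ} (hC : ∀ q, |g q| ≤ C)
    (x : Fin d → ℝ) : |Pop P g x| ≤ C := abs_integral_le_of_bound hC

lemma IsBMC.integral_children_mul_prod (hB : IsBMC Pr X ν P) (i : Word)
    {φ : (Fin d → ℝ) × (Fin d → ℝ) → ℝ} (hφ : Measurable φ) (hφb : ∃ C, ∀ q, |φ q| ≤ C)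
    (N : ℕ) (hN : i.length ≤ N) :
    ∀ ψ : Word → (Fin d → ℝ) → ℝ, (∀ u, Measurable (ψ u)) → (∀ u, ∃ C, ∀ x, |ψ u x| ≤ C) →
      (∀ u, i <+: u → u ≠ i → ψ u = 1) →
      ∫ ω, φ (X (i ++ [false]) ω, X (i ++ [true]) ω) * ∏ u ∈ tree (N + 1), ψ u (X u ω) ∂Pr
        = ∫ ω, Pop P φ (X i ω) * ∏ u ∈ tree (N + 1), ψ u (X u ω) ∂Pr := by
  have hψ2m : ∀ ψ : Word → (Fin d → ℝ) → ℝ, (∀ u, Measurable (ψ u)) → ∀ w : Word,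
      Measurable fun q : (Fin d → ℝ) × (Fin d → ℝ) => ψ (w ++ [false]) q.1 * ψ (w ++ [true]) q.2 :=
    fun ψ hψ w => ((hψ _).comp measurable_fst).mul ((hψ _).comp measurable_snd)
  have hψ2b : ∀ ψ : Word → (Fin d → ℝ) → ℝ, (∀ u, ∃ C, ∀ x, |ψ u x| ≤ C) → ∀ w : Word,
      ∃ C, ∀ q : (Fin d → ℝ) × (Fin d → ℝ), |ψ (w ++ [false]) q.1 * ψ (w ++ [true]) q.2| ≤ C :=
    fun ψ hψ w => exists_bound_mul ((hψ _).imp fun C hC q => hC q.1)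
      ((hψ _).imp fun C hC q => hC q.2)
  have hPφb : ∃ C, ∀ x, |Pop P φ x| ≤ C := hφb.imp fun C hC => abs_Pop_le hC
  have hPφm : Measurable (Pop P φ) := measurable_Pop hφ
  have htreem : ∀ ψ : Word → (Fin d → ℝ) → ℝ, (∀ u, Measurable (ψ u)) → ∀ k : ℕ,
      Measurable[sigmaUpTo X k] fun ω => ∏ u ∈ tree k, ψ u (X u ω) := fun ψ hψ k =>
    Finset.measurable_prod _ fun u hu => (hψ u).comp (measurable_sigmaUpTo X (mem_tree.1 hu))
  have htreeb : ∀ ψ : Word → (Fin d → ℝ) → ℝ, (∀ u, ∃ C, ∀ x, |ψ u x| ≤ C) → ∀ k : ℕ,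
      ∃ C, ∀ ω, |∏ u ∈ tree k, ψ u (X u ω)| ≤ C := fun ψ hψ k =>
    exists_bound_prod _ fun u => (hψ u).imp fun C hC ω => hC _
  induction N, hN using Nat.le_induction with
  | base =>
    intro ψ hψ hψb hψ1
    have hf1 : ψ (i ++ [false]) = 1 := hψ1 _ (List.prefix_append _ _) (by simp)
    have ht1 : ψ (i ++ [true]) = 1 := hψ1 _ (List.prefix_append _ _) (by simp)
    have hi : i ∈ gen i.length := mem_gen.2 rfl
    set g : Word → (Fin d → ℝ) × (Fin d → ℝ) → ℝ := fun w q =>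
      (if w = i then φ q else 1) * (ψ (w ++ [false]) q.1 * ψ (w ++ [true]) q.2) with hg
    have hgm : ∀ w, Measurable (g w) := fun w => by
      by_cases hw : w = i
      · simp only [hg, hw, if_true]; exact hφ.mul (hψ2m ψ hψ i)
      · simp only [hg, hw, if_false, one_mul]; exact hψ2m ψ hψ w
    have hgb : ∀ w, ∃ C, ∀ q, |g w q| ≤ C := fun w => by
      by_cases hw : w = i
      · simp only [hg, hw, if_true]; exact exists_bound_mul hφb (hψ2b ψ hψb i)
      · simp only [hg, hw, if_false, one_mul]; exact hψ2b ψ hψb w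
    have hPg : ∀ w x, Pop P (g w) x = (if w = i then Pop P φ x else 1) *
        Pop P (fun q => ψ (w ++ [false]) q.1 * ψ (w ++ [true]) q.2) x := fun w x => by
      by_cases hw : w = i
      · subst hw
        simp [Pop, hg, hf1, ht1]
      · simp [Pop, hg, hw]
    have e1 := hB.integral_mul_prod i.length (htreem ψ hψ i.length) (htreeb ψ hψb i.length)
      hgm hgb
    have e2 := hB.integral_mul_prod i.length
      (U := fun ω => Pop P φ (X i ω) * ∏ u ∈ tree i.length, ψ u (X u ω))
      ((hPφm.comp (measurable_sigmaUpTo X le_rfl)).mul (htreem ψ hψ i.length))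
      (exists_bound_mul (hPφb.imp fun C hC ω => hC _) (htreeb ψ hψb i.length))
      (hψ2m ψ hψ) (hψ2b ψ hψb)
    simp only [prod_tree_succ, prod_gen_succ]
    simp only [hPg] at e1
    simp only [hg, Finset.prod_mul_distrib, Finset.prod_ite_eq', hi, if_true] at e1 e2
    simp only [Finset.prod_mul_distrib]
    calc _ = _ := integral_congr_ae (Eventually.of_forall fun ω => by ring)
      _ = _ := e1
      _ = _ := integral_congr_ae (Eventually.of_forall fun ω => by ring)
      _ = _ := e2.symm
      _ = _ := integral_congr_ae (Eventually.of_forall fun ω => by ring)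
  | succ N hN ih =>
    intro ψ hψ hψb hψ1
    set ψ' : Word → (Fin d → ℝ) → ℝ := fun u x => ψ u x *
      (if u.length = N + 1 then
        Pop P (fun q => ψ (u ++ [false]) q.1 * ψ (u ++ [true]) q.2) x else 1) with hψ'
    have hψ'm : ∀ u, Measurable (ψ' u) := fun u => by
      by_cases hu : u.length = N + 1
      · simp only [hψ', hu, if_true]; exact (hψ u).mul (measurable_Pop (hψ2m ψ hψ u))
      · simp only [hψ', hu, if_false, mul_one]; exact hψ u
    have hψ'b : ∀ u, ∃ C, ∀ x, |ψ' u x| ≤ C := fun u => by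
      by_cases hu : u.length = N + 1
      · simp only [hψ', hu, if_true]
        exact exists_bound_mul (hψb u) ((hψ2b ψ hψb u).imp fun C hC => abs_Pop_le hC)
      · simp only [hψ', hu, if_false, mul_one]; exact hψb u
    have hψ'1 : ∀ u, i <+: u → u ≠ i → ψ' u = 1 := fun u hu hui => by
      have h0 : ψ u = 1 := hψ1 u hu hui
      have hlen := hu.length_le
      have h1 : ψ (u ++ [false]) = 1 := hψ1 _ (hu.trans (List.prefix_append _ _)) (by
        rintro h; have := congrArg List.length h; simp at this; omega)
      have h2 : ψ (u ++ [true]) = 1 := hψ1 _ (hu.trans (List.prefix_append _ _)) (by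
        rintro h; have := congrArg List.length h; simp at this; omega)
      funext x
      simp [hψ', h0, h1, h2, Pop]
    have hprod : ∀ ω, ∏ u ∈ tree (N + 1), ψ' u (X u ω) =
        (∏ u ∈ tree (N + 1), ψ u (X u ω)) * ∏ u ∈ gen (N + 1),
          Pop P (fun q => ψ (u ++ [false]) q.1 * ψ (u ++ [true]) q.2) (X u ω) := fun ω => by
      simp only [hψ', Finset.prod_mul_distrib]
      congr 1
      rw [prod_tree_succ, Finset.prod_eq_one, one_mul]
      · exact Finset.prod_congr rfl fun u hu => by rw [if_pos (mem_gen.1 hu)]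
      · intro u hu
        rw [if_neg]
        have := mem_tree.1 hu
        omega
    have key := ih ψ' hψ'm hψ'b hψ'1
    have e1 := hB.integral_mul_prod (N + 1)
      (U := fun ω => φ (X (i ++ [false]) ω, X (i ++ [true]) ω) * ∏ u ∈ tree (N + 1), ψ u (X u ω))
      ((hφ.comp ((measurable_sigmaUpTo X (by simp; omega)).prodMk
        (measurable_sigmaUpTo X (by simp; omega)))).mul (htreem ψ hψ (N + 1)))
      (exists_bound_mul (hφb.imp fun C hC ω => hC _) (htreeb ψ hψb (N + 1)))
      (hψ2m ψ hψ) (hψ2b ψ hψb)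
    have e2 := hB.integral_mul_prod (N + 1)
      (U := fun ω => Pop P φ (X i ω) * ∏ u ∈ tree (N + 1), ψ u (X u ω))
      ((hPφm.comp (measurable_sigmaUpTo X (by omega))).mul (htreem ψ hψ (N + 1)))
      (exists_bound_mul (hPφb.imp fun C hC ω => hC _) (htreeb ψ hψb (N + 1)))
      (hψ2m ψ hψ) (hψ2b ψ hψb)
    simp only [prod_tree_succ (N + 1), prod_gen_succ (N + 1)]
    simp only [hprod] at key
    simp only [← mul_assoc] at key e1 e2 ⊢
    rw [e1, key, ← e2]

/-- One-step Markov property with respect to all non-descendants of a vertex. -/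
lemma IsBMC.condExp_children (hB : IsBMC Pr X ν P) (i : Word)
    {φ : (Fin d → ℝ) × (Fin d → ℝ) → ℝ} (hφ : Measurable φ) (hφb : ∃ C, ∀ q, |φ q| ≤ C) :
    Pr[fun ω => φ (X (i ++ [false]) ω, X (i ++ [true]) ω) | sigmaOutside X i]
      =ᵐ[Pr] fun ω => Pop P φ (X i ω) := by
  have hle := sigmaOutside_le hB.meas i
  have hm1 : Measurable fun ω => φ (X (i ++ [false]) ω, X (i ++ [true]) ω) :=
    hφ.comp ((hB.meas _).prodMk (hB.meas _))
  have hm2 : Measurable fun ω => Pop P φ (X i ω) := (measurable_Pop hφ).comp (hB.meas i)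
  obtain ⟨C, hC⟩ := hφb
  have hi1 : Integrable (fun ω => φ (X (i ++ [false]) ω, X (i ++ [true]) ω)) Pr :=
    integrable_of_bound hm1 fun ω => hC _
  have hi2 : Integrable (fun ω => Pop P φ (X i ω)) Pr :=
    integrable_of_bound hm2 fun ω => abs_Pop_le hC _
  have hkey := hB.integral_children_mul_prod i hφ ⟨C, hC⟩
  refine (ae_eq_condExp_of_forall_setIntegral_eq hle hi1 (fun _ _ _ => hi2.integrableOn)
    (fun s hs _ => ?_) ?_).symm
  · have huniv : ∫ ω, Pop P φ (X i ω) ∂Pr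
        = ∫ ω, φ (X (i ++ [false]) ω, X (i ++ [true]) ω) ∂Pr := by
      have h := hkey i.length le_rfl (fun _ _ => 1) (fun _ => measurable_const)
        (fun _ => ⟨1, fun _ => by simp⟩) (fun _ _ _ => rfl)
      simpa using h.symm
    have hgen : sigmaOutside X i = MeasurableSpace.generateFrom (piiUnionInter
        (fun u => {s | MeasurableSet[MeasurableSpace.comap (X u) inferInstance] s})
        {u : Word | i <+: u → u = i}) := (generateFrom_piiUnionInter_measurableSet _ _).symm
    induction s, hs using MeasurableSpace.induction_on_inter hgen
      (isPiSystem_piiUnionInter _ (fun u => @MeasurableSpace.isPiSystem_measurableSet _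
        (MeasurableSpace.comap (X u) inferInstance)) _) with
    | empty => simp
    | basic s hs =>
      obtain ⟨t, ht, A, hA, rfl⟩ := hs
      have hA' : ∀ u, ∃ B : Set (Fin d → ℝ), u ∈ t → MeasurableSet B ∧ X u ⁻¹' B = A u := by
        intro u
        by_cases hu : u ∈ t
        · obtain ⟨B, hB1, hB2⟩ := hA u hu
          exact ⟨B, fun _ => ⟨hB1, hB2⟩⟩
        · exact ⟨∅, fun h => absurd h hu⟩
      choose B hB' using hA'
      classical
      set ψ : Word → (Fin d → ℝ) → ℝ := fun u =>
        if u ∈ t then (B u).indicator 1 else 1 with hψ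
      have hψm : ∀ u, Measurable (ψ u) := fun u => by
        by_cases hu : u ∈ t
        · simp only [hψ, hu, if_true]; exact measurable_one.indicator (hB' u hu).1
        · simp only [hψ, hu, if_false]; exact measurable_one
      have hψb : ∀ u, ∃ C, ∀ x, |ψ u x| ≤ C := fun u => by
        refine ⟨1, fun x => ?_⟩
        by_cases hu : u ∈ t
        · by_cases hx : x ∈ B u <;> simp [hψ, hu, hx]
        · simp [hψ, hu]
      have hψ1 : ∀ u, i <+: u → u ≠ i → ψ u = 1 := fun u hu hui => by
        have : u ∉ t := fun hut => hui (ht hut hu)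
        simp [hψ, this]
      set N := i.length + t.sup List.length with hNdef
      have hsub : t ⊆ tree (N + 1) := fun u hu => by
        have := Finset.le_sup (f := List.length) hu
        rw [mem_tree]
        omega
      have hprod : ∀ ω, ∏ u ∈ tree (N + 1), ψ u (X u ω)
          = (⋂ u ∈ t, A u).indicator (fun _ => (1 : ℝ)) ω := fun ω => by
        rw [← Finset.prod_subset hsub (fun u _ hu => by simp [hψ, hu])]
        by_cases hω : ω ∈ ⋂ u ∈ t, A u
        · rw [Set.indicator_of_mem hω]
          refine Finset.prod_eq_one fun u hu => ?_
          have h1 : ω ∈ A u := Set.mem_iInter₂.1 hω u hu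
          rw [← (hB' u hu).2] at h1
          simp [hψ, hu, Set.mem_preimage.1 h1]
        · rw [Set.indicator_of_notMem hω]
          simp only [Set.mem_iInter, not_forall] at hω
          obtain ⟨u, hu, h1⟩ := hω
          rw [← (hB' u hu).2] at h1
          refine Finset.prod_eq_zero hu ?_
          rw [Set.mem_preimage] at h1
          simp [hψ, hu, h1]
      have hAm : MeasurableSet (⋂ u ∈ t, A u) := Finset.measurableSet_biInter _ fun u hu => by
        rw [← (hB' u hu).2]
        exact hB.meas u (hB' u hu).1
      have h := hkey N (by omega) ψ hψm hψb hψ1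
      simp only [hprod] at h
      rw [← integral_indicator hAm, ← integral_indicator hAm]
      refine Eq.trans (integral_congr_ae (Eventually.of_forall fun ω => ?_))
        (h.symm.trans (integral_congr_ae (Eventually.of_forall fun ω => ?_)))
      · by_cases hω : ω ∈ ⋂ u ∈ t, A u <;> simp only [Set.indicator, hω] <;> simp
      · by_cases hω : ω ∈ ⋂ u ∈ t, A u <;> simp only [Set.indicator, hω] <;> simp
    | compl s hs ih =>
      have h1 := integral_add_compl (hle s hs) hi1
      have h2 := integral_add_compl (hle s hs) hi2
      have h3 := ih (measure_lt_top _ _)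
      linarith
    | iUnion f hd hf ih =>
      rw [integral_iUnion (fun n => hle _ (hf n)) hd hi1.integrableOn,
        integral_iUnion (fun n => hle _ (hf n)) hd hi2.integrableOn]
      exact tsum_congr fun n => ih n (measure_lt_top _ _)
  · exact ((measurable_Pop hφ).comp
      (measurable_sigmaOutside X fun _ => rfl)).aestronglyMeasurable

end Markov

/-- `mom P g k j x` is the `j`-th moment of `∑ g(X_w)`, `w` ranging over the `k`-th generation,
for the chain started at `x`. -/
def mom (P : Kernel (Fin d → ℝ) ((Fin d → ℝ) × (Fin d → ℝ))) (g : (Fin d → ℝ) → ℝ) :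
    ℕ → ℕ → (Fin d → ℝ) → ℝ
  | 0, j => fun x => g x ^ j
  | k + 1, j => Pop P fun q => ∑ m ∈ Finset.range (j + 1),
      (j.choose m : ℝ) * (mom P g k m q.1 * mom P g k (j - m) q.2)

/-- The sum of `g(X_u)` over the descendants `u` of `i`, `k` generations below `i`. -/
def subSum {Ω : Type*} (X : Word → Ω → (Fin d → ℝ)) (i : Word) (k : ℕ) (g : (Fin d → ℝ) → ℝ)
    (ω : Ω) : ℝ := ∑ w ∈ gen k, g (X (i ++ w) ω)

lemma exists_bound_sum {α ι : Type*} (s : Finset ι) {g : ι → α → ℝ}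
    (hg : ∀ i, ∃ C, ∀ x, |g i x| ≤ C) : ∃ C, ∀ x, |∑ i ∈ s, g i x| ≤ C := by
  choose C hC using hg
  exact ⟨∑ i ∈ s, C i, fun x => (Finset.abs_sum_le_sum_abs _ _).trans
    (Finset.sum_le_sum fun i _ => hC i x)⟩

lemma exists_bound_pow {α : Type*} {g : α → ℝ} (hg : ∃ C, ∀ x, |g x| ≤ C) (j : ℕ) :
    ∃ C, ∀ x, |g x ^ j| ≤ C := by
  obtain ⟨C, hC⟩ := hg
  exact ⟨C ^ j, fun x => by rw [abs_pow]; exact pow_le_pow_left₀ (abs_nonneg _) (hC x) j⟩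

section Moments

variable {P : Kernel (Fin d → ℝ) ((Fin d → ℝ) × (Fin d → ℝ))} [IsMarkovKernel P]
  {g : (Fin d → ℝ) → ℝ}

lemma measurable_binomial {F : ℕ → (Fin d → ℝ) → ℝ} (hF : ∀ m, Measurable (F m)) (j : ℕ) :
    Measurable fun q : (Fin d → ℝ) × (Fin d → ℝ) => ∑ m ∈ Finset.range (j + 1),
      (j.choose m : ℝ) * (F m q.1 * F (j - m) q.2) :=
  Finset.measurable_sum _ fun _ _ => measurable_const.mul
    (((hF _).comp measurable_fst).mul ((hF _).comp measurable_snd))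

lemma exists_bound_binomial {F : ℕ → (Fin d → ℝ) → ℝ} (hF : ∀ m, ∃ C, ∀ x, |F m x| ≤ C) (j : ℕ) :
    ∃ C, ∀ q : (Fin d → ℝ) × (Fin d → ℝ), |∑ m ∈ Finset.range (j + 1),
      (j.choose m : ℝ) * (F m q.1 * F (j - m) q.2)| ≤ C :=
  exists_bound_sum _ fun m => exists_bound_mul ⟨_, fun _ => le_rfl⟩
    (exists_bound_mul ((hF m).imp fun _ hC q => hC q.1) ((hF (j - m)).imp fun _ hC q => hC q.2))

lemma measurable_mom (hg : Measurable g) (k j : ℕ) : Measurable (mom P g k j) := by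
  induction k generalizing j with
  | zero => exact hg.pow_const j
  | succ k ih => exact measurable_Pop (measurable_binomial ih j)

lemma exists_bound_mom (hgb : ∃ C, ∀ x, |g x| ≤ C) (k j : ℕ) :
    ∃ C, ∀ x, |mom P g k j x| ≤ C := by
  induction k generalizing j with
  | zero => exact exists_bound_pow hgb j
  | succ k ih => exact (exists_bound_binomial ih j).imp fun C hC => abs_Pop_le hC

variable {Ω : Type*} [MeasurableSpace Ω] {Pr : Measure Ω} [IsProbabilityMeasure Pr]
  {X : Word → Ω → (Fin d → ℝ)} {ν : Measure (Fin d → ℝ)}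

omit [MeasurableSpace Ω] in
lemma subSum_zero (X : Word → Ω → (Fin d → ℝ)) (i : Word) (g : (Fin d → ℝ) → ℝ) :
    subSum X i 0 g = fun ω => g (X i ω) := by
  funext ω
  simp [subSum, gen_zero]

omit [MeasurableSpace Ω] in
lemma subSum_succ (X : Word → Ω → (Fin d → ℝ)) (i : Word) (k : ℕ) (g : (Fin d → ℝ) → ℝ) (ω : Ω) :
    subSum X i (k + 1) g ω
      = subSum X (i ++ [false]) k g ω + subSum X (i ++ [true]) k g ω := by
  simp [subSum, sum_gen_succ]

omit [MeasurableSpace Ω] in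
lemma measurable_subSum {m : MeasurableSpace Ω} {i : Word} (hX : ∀ w, Measurable[m] (X (i ++ w)))
    (hg : Measurable g) (k : ℕ) : Measurable[m] (subSum X i k g) :=
  Finset.measurable_sum _ fun w _ => hg.comp (hX w)

omit [MeasurableSpace Ω] in
lemma exists_bound_subSum (X : Word → Ω → (Fin d → ℝ)) (hgb : ∃ C, ∀ x, |g x| ≤ C) (i : Word)
    (k : ℕ) : ∃ C, ∀ ω, |subSum X i k g ω| ≤ C :=
  exists_bound_sum _ fun _ => hgb.imp fun _ hC _ => hC _

lemma integrable_of_exists_bound {m : Measure Ω} [IsFiniteMeasure m] {F : Ω → ℝ}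
    (hF : Measurable F) (hb : ∃ C, ∀ x, |F x| ≤ C) : Integrable F m :=
  hb.elim fun _ hC => integrable_of_bound hF hC

/-- Conditionally on the non-descendants of a vertex, powers of sums over its `k`-th generation
descendants have the moments of the chain started there. -/
lemma IsBMC.condExp_subSum_pow (hB : IsBMC Pr X ν P) (hg : Measurable g)
    (hgb : ∃ C, ∀ x, |g x| ≤ C) (k j : ℕ) (i : Word) :
    Pr[fun ω => subSum X i k g ω ^ j | sigmaOutside X i]
      =ᵐ[Pr] fun ω => mom P g k j (X i ω) := by
  induction k generalizing i j with
  | zero =>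
    rw [subSum_zero, condExp_of_stronglyMeasurable (sigmaOutside_le hB.meas i)]
    · rfl
    · exact ((hg.comp (measurable_sigmaOutside X fun _ => rfl)).pow_const j).stronglyMeasurable
    · exact integrable_of_exists_bound ((hg.comp (hB.meas i)).pow_const j)
        (exists_bound_pow (hgb.imp fun C hC ω => hC _) j)
  | succ k ih =>
    set A : Ω → ℝ := subSum X (i ++ [false]) k g with hA
    set B : Ω → ℝ := subSum X (i ++ [true]) k g with hB'
    have hAm : Measurable A := measurable_subSum (fun w => hB.meas _) hg k
    have hBm : Measurable B := measurable_subSum (fun w => hB.meas _) hg k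
    have hAb : ∃ C, ∀ ω, |A ω| ≤ C := exists_bound_subSum X hgb _ k
    have hBb : ∃ C, ∀ ω, |B ω| ≤ C := exists_bound_subSum X hgb _ k
    have hmm : ∀ m u, Measurable fun ω => mom P g k m (X u ω) := fun m u =>
      (measurable_mom hg k m).comp (hB.meas u)
    have hmb : ∀ m u, ∃ C, ∀ ω, |mom P g k m (X u ω)| ≤ C := fun m u =>
      (exists_bound_mom hgb k m).imp fun C hC ω => hC _
    have hAmT : Measurable[sigmaOutside X (i ++ [true])] A :=
      measurable_subSum (fun w => measurable_sigmaOutside X fun h => by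
        rw [List.append_assoc, List.prefix_append_right_inj] at h
        simp at h) hg k
    have hpair : ∀ m r, Pr[fun ω => A ω ^ m * B ω ^ r | sigmaOutside X i] =ᵐ[Pr]
        Pr[fun ω => mom P g k m (X (i ++ [false]) ω) * mom P g k r (X (i ++ [true]) ω)
          | sigmaOutside X i] := by
      intro m r
      have h1 : Pr[fun ω => A ω ^ m * B ω ^ r | sigmaOutside X (i ++ [true])] =ᵐ[Pr]
          fun ω => A ω ^ m * mom P g k r (X (i ++ [true]) ω) := by
        refine (condExp_mul_of_stronglyMeasurable_left
          (f := fun ω => A ω ^ m) (g := fun ω => B ω ^ r)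
          (hAmT.pow_const m).stronglyMeasurable
          (integrable_of_exists_bound ((hAm.pow_const m).mul (hBm.pow_const r))
            (exists_bound_mul (exists_bound_pow hAb m) (exists_bound_pow hBb r)))
          (integrable_of_exists_bound (hBm.pow_const r) (exists_bound_pow hBb r))).trans ?_
        filter_upwards [ih r (i ++ [true])] with ω hω
        rw [Pi.mul_apply, hω]
      have h2 : Pr[fun ω => A ω ^ m * mom P g k r (X (i ++ [true]) ω)
          | sigmaOutside X (i ++ [false])] =ᵐ[Pr]
          fun ω => mom P g k m (X (i ++ [false]) ω) * mom P g k r (X (i ++ [true]) ω) := by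
        refine (condExp_mul_of_stronglyMeasurable_right
          (f := fun ω => A ω ^ m) (g := fun ω => mom P g k r (X (i ++ [true]) ω))
          ((measurable_mom hg k r).comp (measurable_sigmaOutside X fun h => by
            rw [List.prefix_append_right_inj] at h
            simp at h)).stronglyMeasurable
          (integrable_of_exists_bound ((hAm.pow_const m).mul (hmm r _))
            (exists_bound_mul (exists_bound_pow hAb m) (hmb r _)))
          (integrable_of_exists_bound (hAm.pow_const m) (exists_bound_pow hAb m))).trans ?_
        filter_upwards [ih m (i ++ [false])] with ω hω
        rw [Pi.mul_apply, hω]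
      have h3 := (condExp_condExp_of_le (μ := Pr) (f := fun ω => A ω ^ m * B ω ^ r)
        (sigmaOutside_mono X (List.prefix_append i [true])) (sigmaOutside_le hB.meas _)).symm
      have h4 := (condExp_condExp_of_le (μ := Pr)
        (f := fun ω => A ω ^ m * mom P g k r (X (i ++ [true]) ω))
        (sigmaOutside_mono X (List.prefix_append i [false])) (sigmaOutside_le hB.meas _)).symm
      exact h3.trans ((condExp_congr_ae h1).trans (h4.trans (condExp_congr_ae h2)))
    have hpow : (fun ω => subSum X i (k + 1) g ω ^ j) = ∑ m ∈ Finset.range (j + 1),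
        (j.choose m : ℝ) • fun ω => A ω ^ m * B ω ^ (j - m) := by
      funext ω
      rw [subSum_succ, add_pow, Finset.sum_apply]
      exact Finset.sum_congr rfl fun m _ => by
        simp only [Pi.smul_apply, smul_eq_mul, hA, hB']; ring
    have hmom := hB.condExp_children i
      (φ := fun q => ∑ m ∈ Finset.range (j + 1),
        (j.choose m : ℝ) * (mom P g k m q.1 * mom P g k (j - m) q.2))
      (measurable_binomial (measurable_mom hg k) j)
      (exists_bound_binomial (exists_bound_mom hgb k) j)
    refine EventuallyEq.trans ?_ hmom
    have hsum : (fun ω => ∑ m ∈ Finset.range (j + 1), (j.choose m : ℝ) *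
        (mom P g k m (X (i ++ [false]) ω) * mom P g k (j - m) (X (i ++ [true]) ω)))
        = ∑ m ∈ Finset.range (j + 1), (j.choose m : ℝ) • fun ω =>
          mom P g k m (X (i ++ [false]) ω) * mom P g k (j - m) (X (i ++ [true]) ω) := by
      funext ω
      rw [Finset.sum_apply]
      rfl
    rw [hpow, hsum]
    refine (condExp_finsetSum (fun m _ => ?_) _).trans
      (EventuallyEq.trans ?_ (condExp_finsetSum (fun m _ => ?_) _).symm)
    · exact (integrable_of_exists_bound ((hAm.pow_const m).mul (hBm.pow_const _))
        (exists_bound_mul (exists_bound_pow hAb m) (exists_bound_pow hBb _))).smul _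
    · refine eventuallyEq_sum fun m _ => ?_
      refine (condExp_smul _ _ _).trans (EventuallyEq.trans ?_ (condExp_smul _ _ _).symm)
      exact (hpair m (j - m)).const_smul _
    · exact (integrable_of_exists_bound ((hmm m _).mul (hmm _ _))
        (exists_bound_mul (hmb m _) (hmb _ _))).smul _

lemma IsBMC.condExp_subSum_pow_Fsig (hB : IsBMC Pr X ν P) (hg : Measurable g)
    (hgb : ∃ C, ∀ x, |g x| ≤ C) (k j : ℕ) (i : Word) :
    Pr[fun ω => subSum X i k g ω ^ j | Fsig X i] =ᵐ[Pr] fun ω => mom P g k j (X i ω) := by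
  refine (condExp_condExp_of_le (Fsig_le_sigmaOutside X i)
    (sigmaOutside_le hB.meas i)).symm.trans ?_
  refine (condExp_congr_ae (hB.condExp_subSum_pow hg hgb k j i)).trans ?_
  rw [condExp_of_stronglyMeasurable (Fsig_le hB.meas i)]
  · exact ((measurable_mom hg k j).comp
      (measurable_Fsig X (Or.inl (List.prefix_refl i)))).stronglyMeasurable
  · exact integrable_of_exists_bound ((measurable_mom hg k j).comp (hB.meas i))
      ((exists_bound_mom hgb k j).imp fun C hC ω => hC _)

end Moments

section MomentBounds

variable {P : Kernel (Fin d → ℝ) ((Fin d → ℝ) × (Fin d → ℝ))} [IsMarkovKernel P]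
  {g : (Fin d → ℝ) → ℝ}

lemma mom_zero_right (g : (Fin d → ℝ) → ℝ) (k : ℕ) (x : Fin d → ℝ) : mom P g k 0 x = 1 := by
  induction k generalizing x with
  | zero => simp [mom]
  | succ k ih => simp [mom, Pop, ih]

omit [IsMarkovKernel P] in
lemma Qop_const_mul (c : ℝ) (F : (Fin d → ℝ) → ℝ) (x : Fin d → ℝ) :
    Qop P (fun y => c * F y) x = c * Qop P F x := by
  simp only [Qop, ← mul_add, integral_const_mul]
  ring

lemma mom_one_right (g : (Fin d → ℝ) → ℝ) (k : ℕ) (x : Fin d → ℝ) :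
    mom P g k 1 x = 2 ^ k * (Qop P)^[k] g x := by
  induction k generalizing x with
  | zero => simp [mom]
  | succ k ih =>
    have h1 : mom P g (k + 1) 1 x = 2 * Qop P (fun y => 2 ^ k * (Qop P)^[k] g y) x := by
      simp only [mom, Pop, Qop, Finset.sum_range_succ, Finset.sum_range_zero, mom_zero_right, ih]
      simp only [Nat.choose_zero_right, Nat.choose_self, Nat.cast_one, one_mul, zero_add,
        mul_one, tsub_self, mom_zero_right]
      rw [mul_div_cancel₀ _ two_ne_zero]
      exact integral_congr_ae (Eventually.of_forall fun q => by ring)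
    rw [h1, Qop_const_mul, Function.iterate_succ_apply']
    ring

lemma measurable_Qop (hg : Measurable g) : Measurable (Qop P g) :=
  (measurable_integral_kernel P
    ((hg.comp measurable_fst).add (hg.comp measurable_snd))).div_const 2

lemma abs_mom_succ_le {k j : ℕ} {β : ℕ → ℝ} (hβ : ∀ m ≤ j, ∀ y, |mom P g k m y| ≤ β m)
    (x : Fin d → ℝ) : |mom P g (k + 1) j x| ≤
      ∑ m ∈ Finset.range (j + 1), (j.choose m : ℝ) * (β m * β (j - m)) := by
  refine abs_Pop_le (fun q => ?_) x
  refine (Finset.abs_sum_le_sum_abs _ _).trans (Finset.sum_le_sum fun m hm => ?_)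
  rw [Finset.mem_range] at hm
  rw [abs_mul, abs_mul, Nat.abs_cast]
  have h1 := hβ m (by omega) q.1
  have h2 := hβ (j - m) (by omega) q.2
  exact mul_le_mul_of_nonneg_left
    (mul_le_mul h1 h2 (abs_nonneg _) ((abs_nonneg _).trans h1)) (Nat.cast_nonneg _)

lemma abs_mom_one_le (hg : Measurable g) {B C : ℝ} (hgB : ∀ x, |g x| ≤ B)
    (hQ2 : ∀ x, Qop P (fun y => g y ^ 2) x ≤ C) (j : ℕ) (x : Fin d → ℝ) :
    |mom P g 1 (j + 2) x| ≤ (2 * B) ^ j * (4 * C) := by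
  have hB : 0 ≤ B := (abs_nonneg _).trans (hgB x)
  have h1 : mom P g 1 (j + 2) x = ∫ q, (g q.1 + g q.2) ^ (j + 2) ∂(P x) := by
    simp only [mom, Pop]
    refine integral_congr_ae (Eventually.of_forall fun q => ?_)
    simp only [add_pow (g q.1)]
    exact Finset.sum_congr rfl fun m _ => by ring
  have hsq : Integrable (fun q : (Fin d → ℝ) × (Fin d → ℝ) => g q.1 ^ 2 + g q.2 ^ 2) (P x) :=
    integrable_of_exists_bound (((hg.comp measurable_fst).pow_const 2).add
      ((hg.comp measurable_snd).pow_const 2)) ⟨B ^ 2 + B ^ 2, fun q => by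
        rw [abs_of_nonneg (by positivity)]
        exact add_le_add (sq_le_sq' (abs_le.1 (hgB _)).1 (abs_le.1 (hgB _)).2)
          (sq_le_sq' (abs_le.1 (hgB _)).1 (abs_le.1 (hgB _)).2)⟩
  rw [h1, ← Real.norm_eq_abs]
  calc ‖∫ q, (g q.1 + g q.2) ^ (j + 2) ∂(P x)‖
      ≤ ∫ q, (2 * B) ^ j * 2 * (g q.1 ^ 2 + g q.2 ^ 2) ∂(P x) := by
        refine norm_integral_le_of_norm_le (hsq.const_mul _) (Eventually.of_forall fun q => ?_)
        rw [Real.norm_eq_abs, abs_pow, pow_add, sq_abs]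
        have h2 : |g q.1 + g q.2| ≤ 2 * B :=
          (abs_add_le _ _).trans (by linarith [hgB q.1, hgB q.2])
        have h3 : (g q.1 + g q.2) ^ 2 ≤ 2 * (g q.1 ^ 2 + g q.2 ^ 2) := by
          nlinarith [sq_nonneg (g q.1 - g q.2)]
        rw [mul_assoc]
        exact mul_le_mul (pow_le_pow_left₀ (abs_nonneg _) h2 j) h3 (sq_nonneg _) (by positivity)
    _ = (2 * B) ^ j * (4 * Qop P (fun y => g y ^ 2) x) := by
        rw [integral_const_mul, Qop]
        ring
    _ ≤ _ := by gcongr; exact hQ2 x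

lemma abs_mom_first_le (hg : Measurable g) {μm : Measure (Fin d → ℝ)}
    (hinv : IsInvariantQ P μm) {M κ : ℝ} (hM : 0 ≤ M) (hκ1 : 1 ≤ κ)
    (herg : ErgodicQ P μm M (κ / 2)) (hgb : ∃ C, ∀ x, |g x| ≤ C) (hμ : ∫ x, g x ∂μm = 0)
    {C η : ℝ} (hQ : ∀ x, |Qop P g x| ≤ C * η) (k : ℕ) (hk : 1 ≤ k) (x : Fin d → ℝ) :
    |mom P g k 1 x| ≤ 2 * M * C * (κ ^ k * η) := by
  obtain ⟨k, rfl⟩ := Nat.exists_eq_add_of_le' hk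
  have hCη : 0 ≤ C * η := (abs_nonneg _).trans (hQ x)
  have h := herg (Qop P g) (C * η) (measurable_Qop hg) hQ k x
  rw [hinv g hg hgb, hμ, sub_zero] at h
  rw [mom_one_right, Function.iterate_succ_apply, abs_mul, abs_of_pos (by positivity)]
  calc (2 : ℝ) ^ (k + 1) * |(Qop P)^[k] (Qop P g) x|
      ≤ 2 ^ (k + 1) * (M * (κ / 2) ^ k * (C * η)) := by gcongr
    _ = 2 * M * (C * η) * κ ^ k := by
        rw [div_pow, pow_succ]
        field_simp
    _ ≤ 2 * M * (C * η) * κ ^ (k + 1) := by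
        gcongr
        omega
    _ = _ := by ring

/-- Uniform fourth moment bound for centered functions in the bandwidth regime. -/
lemma exists_mom_bound (M C κ : ℝ) (hM : 0 < M) (hC : 0 ≤ C) (hκ1 : 1 < κ) (hκ2 : κ < 2) :
    ∃ D : ℝ, 0 ≤ D ∧ ∀ (P : Kernel (Fin d → ℝ) ((Fin d → ℝ) × (Fin d → ℝ))) [IsMarkovKernel P]
      (μm : Measure (Fin d → ℝ)) (g : (Fin d → ℝ) → ℝ) (η : ℝ) (n : ℕ),
      IsInvariantQ P μm → ErgodicQ P μm M (κ / 2) → Measurable g → ∫ x, g x ∂μm = 0 → 0 < η →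
      (∀ x, η * |g x| ≤ C) → (∀ x, |Qop P g x| ≤ C * η) →
      (∀ x, Qop P (fun y => g y ^ 2) x ≤ C) → κ ^ n * η ^ 2 ≤ 1 →
      ∀ k, 1 ≤ k → k ≤ n → ∀ x,
        mom P g k 4 x + mom P g k 1 x ^ 4 ≤ D * (2 ^ k / η ^ 2 + 4 ^ k) := by
  set D1 := 2 * M * C with hD1
  have hD1' : 0 ≤ D1 := by positivity
  have h2κ : 0 < 2 - κ := by linarith
  have hκ1' : 0 < κ - 1 := by linarith
  set c2 := 2 * D1 ^ 2 / (2 - κ) with hc2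
  have hc2' : 0 ≤ c2 := by positivity
  have hc2e : c2 * (2 - κ) = 2 * D1 ^ 2 := by rw [hc2]; field_simp
  set a2 := 2 * C + c2 with ha2
  have ha2' : 0 ≤ a2 := by positivity
  set c3 := 3 * a2 * D1 / (κ - 1) with hc3
  have hc3' : 0 ≤ c3 := by positivity
  have hc3e : c3 * (κ - 1) = 3 * a2 * D1 := by rw [hc3]; field_simp
  set b3 := 4 * C ^ 2 + c3 with hb3
  have hb3' : 0 ≤ b3 := by positivity
  set c4 := (8 * b3 * D1 + 6 * a2 ^ 2) / 2 with hc4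
  have hc4' : 0 ≤ c4 := by positivity
  refine ⟨8 * C ^ 3 + c4 + D1 ^ 4, by positivity, ?_⟩
  intro P _ μm g η n hinv herg hg hμ hη hgC hQ hQ2 hκn
  have hκ0 : 0 < κ := by linarith
  have hgB : ∀ x, |g x| ≤ C / η := fun x => by
    rw [le_div_iff₀ hη, mul_comm]; exact hgC x
  have hκk : ∀ k ≤ n, κ ^ k * η ^ 2 ≤ 1 := fun k hk =>
    (mul_le_mul_of_nonneg_right (pow_le_pow_right₀ hκ1.le hk) (sq_nonneg η)).trans hκn
  have h0 : ∀ k x, |mom P g k 0 x| ≤ 1 := fun k x => by rw [mom_zero_right]; simp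
  have h1 : ∀ k, 1 ≤ k → ∀ x, |mom P g k 1 x| ≤ D1 * (κ ^ k * η) := fun k hk x =>
    abs_mom_first_le hg hinv hM.le hκ1.le herg ⟨_, hgB⟩ hμ hQ k hk x
  have h2 : ∀ k, 1 ≤ k → k ≤ n → ∀ x, |mom P g k 2 x| ≤ a2 * 2 ^ k - c2 * κ ^ k := by
    intro k hk
    induction k, hk using Nat.le_induction with
    | base =>
      intro _ x
      have := abs_mom_one_le hg hgB hQ2 0 x
      norm_num at this
      rw [ha2]
      nlinarith
    | succ k hk ih =>
      intro hkn x
      have hstep := abs_mom_succ_le (P := P) (g := g) (k := k) (j := 2)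
        (β := fun m => match m with
          | 0 => 1
          | 1 => D1 * (κ ^ k * η)
          | _ => a2 * 2 ^ k - c2 * κ ^ k)
        (fun m hm y => by
          interval_cases m
          · exact h0 k y
          · exact h1 k hk y
          · exact ih (by omega) y) x
      simp only [Finset.sum_range_succ, Finset.sum_range_zero, Nat.choose] at hstep
      norm_num at hstep
      refine hstep.trans ?_
      have e1 : (κ ^ k * η) * (κ ^ k * η) ≤ κ ^ k := by
        have := mul_le_mul_of_nonneg_left (hκk k (by omega)) (pow_nonneg hκ0.le k)
        linarith
      have e2 : D1 ^ 2 * ((κ ^ k * η) * (κ ^ k * η)) ≤ D1 ^ 2 * κ ^ k := by gcongr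
      have e3 : c2 * (2 - κ) * κ ^ k = 2 * D1 ^ 2 * κ ^ k := by rw [hc2e]
      rw [pow_succ, pow_succ]
      linarith
  have h2' : ∀ k, 1 ≤ k → k ≤ n → ∀ x, |mom P g k 2 x| ≤ a2 * 2 ^ k := fun k hk hkn x =>
    (h2 k hk hkn x).trans (by have : 0 ≤ c2 * κ ^ k := by positivity
                              linarith)
  have h3 : ∀ k, 1 ≤ k → k ≤ n → ∀ x,
      |mom P g k 3 x| ≤ 2 ^ k * (4 * C ^ 2 / η + c3 * (κ ^ k * η)) := by
    intro k hk
    induction k, hk using Nat.le_induction with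
    | base =>
      intro _ x
      have := abs_mom_one_le hg hgB hQ2 1 x
      refine this.trans ?_
      have e : 0 ≤ c3 * (κ ^ 1 * η) := by positivity
      have e2 : (2 * (C / η)) ^ 1 * (4 * C) = 2 ^ 1 * (4 * C ^ 2 / η) := by ring
      rw [e2]
      linarith
    | succ k hk ih =>
      intro hkn x
      have hstep := abs_mom_succ_le (P := P) (g := g) (k := k) (j := 3)
        (β := fun m => match m with
          | 0 => 1
          | 1 => D1 * (κ ^ k * η)
          | 2 => a2 * 2 ^ k
          | _ => 2 ^ k * (4 * C ^ 2 / η + c3 * (κ ^ k * η)))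
        (fun m hm y => by
          interval_cases m
          · exact h0 k y
          · exact h1 k hk y
          · exact h2' k hk (by omega) y
          · exact ih (by omega) y) x
      simp only [Finset.sum_range_succ, Finset.sum_range_zero, Nat.choose] at hstep
      norm_num at hstep
      refine hstep.trans (le_of_eq ?_)
      have e3 : c3 * (κ - 1) * (2 ^ k * κ ^ k * η) = 3 * a2 * D1 * (2 ^ k * κ ^ k * η) := by
        rw [hc3e]
      rw [pow_succ, pow_succ]
      linear_combination (-2) * e3
  have h3' : ∀ k, 1 ≤ k → k ≤ n → ∀ x, |mom P g k 3 x| ≤ 2 ^ k * (b3 / η) := fun k hk hkn x => by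
    refine (h3 k hk hkn x).trans ?_
    rw [hb3, add_div]
    have : κ ^ k * η ≤ 1 / η := by
      rw [le_div_iff₀ hη]
      have := hκk k hkn
      linarith
    have := mul_le_mul_of_nonneg_left this hc3'
    gcongr
    linarith [mul_one_div c3 η]
  have h4 : ∀ k, 1 ≤ k → k ≤ n → ∀ x,
      |mom P g k 4 x| ≤ 8 * C ^ 3 * (2 ^ k / η ^ 2) + c4 * 4 ^ k := by
    intro k hk
    induction k, hk using Nat.le_induction with
    | base =>
      intro _ x
      have := abs_mom_one_le hg hgB hQ2 2 x
      refine this.trans ?_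
      have e2 : (2 * (C / η)) ^ 2 * (4 * C) = 8 * C ^ 3 * (2 ^ 1 / η ^ 2) := by ring
      rw [e2]
      have : 0 ≤ c4 * 4 ^ 1 := by positivity
      linarith
    | succ k hk ih =>
      intro hkn x
      have hstep := abs_mom_succ_le (P := P) (g := g) (k := k) (j := 4)
        (β := fun m => match m with
          | 0 => 1
          | 1 => D1 * (κ ^ k * η)
          | 2 => a2 * 2 ^ k
          | 3 => 2 ^ k * (b3 / η)
          | _ => 8 * C ^ 3 * (2 ^ k / η ^ 2) + c4 * 4 ^ k)
        (fun m hm y => by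
          interval_cases m
          · exact h0 k y
          · exact h1 k hk y
          · exact h2' k hk (by omega) y
          · exact h3' k hk (by omega) y
          · exact ih (by omega) y) x
      simp only [Finset.sum_range_succ, Finset.sum_range_zero, Nat.choose] at hstep
      norm_num at hstep
      refine hstep.trans ?_
      have e1 : D1 * (κ ^ k * η) * (2 ^ k * (b3 / η)) = D1 * b3 * (2 ^ k * κ ^ k) := by
        field_simp
      have e1' : (2 ^ k * (b3 / η)) * (D1 * (κ ^ k * η)) = D1 * b3 * (2 ^ k * κ ^ k) := by
        field_simp
      have e0 : (2 : ℝ) ^ k * 2 ^ k = 4 ^ k := by rw [← mul_pow]; norm_num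
      have e2 : (2 : ℝ) ^ k * κ ^ k ≤ 4 ^ k := by
        rw [← e0]; gcongr
      have e3 : D1 * b3 * (2 ^ k * κ ^ k) ≤ D1 * b3 * 4 ^ k := by gcongr
      have e4 : a2 * 2 ^ k * (a2 * 2 ^ k) = a2 ^ 2 * 4 ^ k := by rw [← e0]; ring
      have e5 : 2 * c4 * 4 ^ k = (8 * b3 * D1 + 6 * a2 ^ 2) * 4 ^ k := by rw [hc4]; ring
      have e6 : 8 * C ^ 3 * (2 ^ (k + 1) / η ^ 2) = 2 * (8 * C ^ 3 * (2 ^ k / η ^ 2)) := by ring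
      have e7 : c4 * 4 ^ (k + 1) = 4 * (c4 * 4 ^ k) := by ring
      rw [e1, e1', e4, e6, e7]
      linarith
  intro k hk hkn x
  have f4 := (le_abs_self _).trans (h4 k hk hkn x)
  have f1 : mom P g k 1 x ^ 4 ≤ D1 ^ 4 * 4 ^ k := by
    have e1 : mom P g k 1 x ^ 4 ≤ (D1 * (κ ^ k * η)) ^ 4 := by
      rw [← (show Even 4 by decide).pow_abs]
      exact pow_le_pow_left₀ (abs_nonneg _) (h1 k hk x) 4
    have e2 : (κ ^ k * η ^ 2) ^ 2 ≤ 1 := pow_le_one₀ (by positivity) (hκk k hkn)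
    have e3 : (κ ^ k) ^ 2 ≤ 4 ^ k := by
      rw [← pow_mul, mul_comm, pow_mul]
      gcongr
      nlinarith
    calc _ ≤ _ := e1
      _ = D1 ^ 4 * ((κ ^ k) ^ 2 * (κ ^ k * η ^ 2) ^ 2) := by ring
      _ ≤ D1 ^ 4 * (4 ^ k * 1) := by gcongr
      _ = _ := by ring
  have g1 : 0 ≤ 2 ^ k / η ^ 2 := by positivity
  have g2 : (0 : ℝ) ≤ 4 ^ k := by positivity
  have g3 : 0 ≤ 8 * C ^ 3 := by positivity
  have g4 : 0 ≤ D1 ^ 4 := by positivity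
  calc _ ≤ 8 * C ^ 3 * (2 ^ k / η ^ 2) + c4 * 4 ^ k + D1 ^ 4 * 4 ^ k := add_le_add f4 f1
    _ ≤ (8 * C ^ 3 + c4 + D1 ^ 4) * (2 ^ k / η ^ 2) + (8 * C ^ 3 + c4 + D1 ^ 4) * 4 ^ k := by
      nlinarith [mul_nonneg hc4' g1, mul_nonneg g4 g1, mul_nonneg g3 g2]
    _ = _ := by ring

end MomentBounds

lemma bandwidth_pos (γ : ℝ) (n : ℕ) : 0 < bandwidth γ n := Real.rpow_pos_of_pos two_pos _

lemma bandwidth_le_one {γ : ℝ} (hγ : 0 ≤ γ) (n : ℕ) : bandwidth γ n ≤ 1 :=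
  Real.rpow_le_one_of_one_le_of_nonpos one_le_two
    (by have : (0 : ℝ) ≤ n := Nat.cast_nonneg n
        nlinarith)

lemma bandwidth_rpow_half_sq (γ : ℝ) (n d : ℕ) :
    (bandwidth γ n ^ ((d : ℝ) / 2)) ^ 2 = bandwidth γ n ^ (d : ℝ) := by
  rw [← Real.rpow_natCast, ← Real.rpow_mul (bandwidth_pos γ n).le]
  congr 1
  push_cast
  ring

lemma bandwidth_rpow_dim (γ : ℝ) (n d : ℕ) :
    bandwidth γ n ^ (d : ℝ) = ((2 : ℝ) ^ (-((d : ℝ) * γ))) ^ n := by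
  rw [bandwidth, ← Real.rpow_natCast (_ ^ _) n, ← Real.rpow_mul two_pos.le,
    ← Real.rpow_mul two_pos.le]
  congr 1
  ring

/-- The ergodicity rate may be enlarged to lie in `(1/2, 1)` in the bandwidth regime. -/
lemma exists_rate {d : ℕ} (hd : 1 ≤ d) {α γ : ℝ} (hα1 : α < 1) (hγ0 : 0 < γ)
    (hγd : γ < 1 / (d : ℝ))
    (hα2 : 1 / 2 < α →
      Tendsto (fun n : ℕ => ((2 : ℝ) ^ (1 - (d : ℝ) * γ) * α) ^ n) atTop (nhds 0)) :
    ∃ κ : ℝ, 1 < κ ∧ κ < 2 ∧ α ≤ κ / 2 ∧ κ * 2 ^ (-((d : ℝ) * γ)) ≤ 1 := by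
  have hd0 : (0 : ℝ) < d := by exact_mod_cast hd
  by_cases hα : 1 / 2 < α
  · refine ⟨2 * α, by linarith, by linarith, by linarith, ?_⟩
    have h := tendsto_pow_atTop_nhds_zero_iff.1 (hα2 hα)
    have h2 := (le_abs_self _).trans h.le
    rw [sub_eq_add_neg, Real.rpow_add two_pos, Real.rpow_one] at h2
    linarith
  · have hdγ : (d : ℝ) * γ < 1 := by
      rw [lt_div_iff₀ hd0] at hγd
      linarith
    have hdγ0 : 0 < (d : ℝ) * γ := by positivity
    have h1 : (1 : ℝ) < 2 ^ ((d : ℝ) * γ) := Real.one_lt_rpow one_lt_two hdγ0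
    refine ⟨2 ^ ((d : ℝ) * γ), h1, ?_, by linarith, ?_⟩
    · calc (2 : ℝ) ^ ((d : ℝ) * γ) < 2 ^ (1 : ℝ) := Real.rpow_lt_rpow_of_exponent_lt one_lt_two hdγ
        _ = 2 := Real.rpow_one 2
    · rw [← Real.rpow_add two_pos]
      simp

lemma ErgodicQ.mono {P : Kernel (Fin d → ℝ) ((Fin d → ℝ) × (Fin d → ℝ))}
    {μm : Measure (Fin d → ℝ)} {M α β : ℝ} (hM : 0 ≤ M) (hα : 0 ≤ α) (hαβ : α ≤ β)
    (h : ErgodicQ P μm M α) : ErgodicQ P μm M β := by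
  intro f C hf hC n x
  have hC0 : 0 ≤ C := (abs_nonneg _).trans (hC x)
  refine (h f C hf hC n x).trans ?_
  gcongr

section Increments

variable {P : Kernel (Fin d → ℝ) ((Fin d → ℝ) × (Fin d → ℝ))} [IsMarkovKernel P]
  {μm : Measure (Fin d → ℝ)} [IsProbabilityMeasure μm]

omit [IsProbabilityMeasure μm] in
lemma measurable_tilde {g : (Fin d → ℝ) → ℝ} (hg : Measurable g) : Measurable (tilde μm g) :=
  hg.sub_const _

lemma integral_tilde {g : (Fin d → ℝ) → ℝ} (hg : Measurable g) (hgb : ∃ C, ∀ x, |g x| ≤ C) :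
    ∫ x, tilde μm g x ∂μm = 0 := by
  simp only [tilde]
  rw [integral_sub (integrable_of_exists_bound hg hgb) (integrable_const _)]
  simp

omit [IsProbabilityMeasure μm] in
lemma Qop_tilde {g : (Fin d → ℝ) → ℝ} (hg : Measurable g) (hgb : ∃ C, ∀ x, |g x| ≤ C)
    (x : Fin d → ℝ) : Qop P (tilde μm g) x = Qop P g x - ∫ y, g y ∂μm := by
  simp only [Qop, tilde]
  have h : ∀ q : (Fin d → ℝ) × (Fin d → ℝ), g q.1 - ∫ y, g y ∂μm + (g q.2 - ∫ y, g y ∂μm)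
      = (g q.1 + g q.2) - 2 * ∫ y, g y ∂μm := fun q => by ring
  simp only [h]
  rw [integral_sub _ (integrable_const _)]
  · simp
    ring
  · exact (integrable_of_exists_bound (hg.comp measurable_fst) (hgb.imp fun C hC q => hC _)).add
      (integrable_of_exists_bound (hg.comp measurable_snd) (hgb.imp fun C hC q => hC _))

lemma Qop_mono {g h : (Fin d → ℝ) → ℝ} (hg : Measurable g) (hgb : ∃ C, ∀ x, |g x| ≤ C)
    (hh : Measurable h) (hhb : ∃ C, ∀ x, |h x| ≤ C) (hgh : ∀ x, g x ≤ h x) (x : Fin d → ℝ) :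
    Qop P g x ≤ Qop P h x := by
  simp only [Qop]
  refine div_le_div_of_nonneg_right (integral_mono ?_ ?_ fun q => ?_) two_pos.le
  · exact (integrable_of_exists_bound (hg.comp measurable_fst) (hgb.imp fun C hC q => hC _)).add
      (integrable_of_exists_bound (hg.comp measurable_snd) (hgb.imp fun C hC q => hC _))
  · exact (integrable_of_exists_bound (hh.comp measurable_fst) (hhb.imp fun C hC q => hC _)).add
      (integrable_of_exists_bound (hh.comp measurable_snd) (hhb.imp fun C hC q => hC _))
  · exact add_le_add (hgh _) (hgh _)

omit [IsProbabilityMeasure μm] in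
lemma Qop_tilde_sq_le {g : (Fin d → ℝ) → ℝ} (hg : Measurable g) (hgb : ∃ C, ∀ x, |g x| ≤ C)
    (x : Fin d → ℝ) : Qop P (fun y => tilde μm g y ^ 2) x
      ≤ 2 * Qop P (fun y => g y ^ 2) x + 2 * (∫ y, g y ∂μm) ^ 2 := by
  set c := ∫ y, g y ∂μm with hc
  have hgb2 := exists_bound_pow hgb 2
  have htb : ∃ C, ∀ x, |tilde μm g x| ≤ C := by
    obtain ⟨C, hC⟩ := hgb
    refine ⟨C + |c|, fun x => ?_⟩
    have := abs_sub (g x) c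
    rw [tilde]
    linarith [hC x]
  have h1 := Qop_mono (P := P) (h := fun y => 2 * g y ^ 2 + 2 * c ^ 2)
    ((measurable_tilde (μm := μm) hg).pow_const 2)
    (exists_bound_pow htb 2) (((hg.pow_const 2).const_mul 2).add_const _) (by
      obtain ⟨C, hC⟩ := hgb2
      refine ⟨2 * C + 2 * c ^ 2, fun x => ?_⟩
      rw [abs_of_nonneg (by positivity)]
      linarith [(le_abs_self _).trans (hC x)]) (fun y => by
      simp only [tilde]
      nlinarith [sq_nonneg (g y + c)]) x
  refine h1.trans (le_of_eq ?_)
  simp only [Qop]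
  have h : ∀ q : (Fin d → ℝ) × (Fin d → ℝ), 2 * g q.1 ^ 2 + 2 * c ^ 2 + (2 * g q.2 ^ 2 + 2 * c ^ 2)
      = 2 * (g q.1 ^ 2 + g q.2 ^ 2) + 4 * c ^ 2 := fun q => by ring
  simp only [h]
  rw [integral_add _ (integrable_const _), integral_const_mul]
  · simp
    ring
  · exact ((integrable_of_exists_bound ((hg.pow_const 2).comp measurable_fst)
      (hgb2.imp fun C hC q => hC _)).add (integrable_of_exists_bound
        ((hg.pow_const 2).comp measurable_snd) (hgb2.imp fun C hC q => hC _))).const_mul 2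

lemma sum_pow_four_le (s : Finset ℕ) (a : ℕ → ℝ) :
    (∑ l ∈ s, a l) ^ 4 ≤ (s.card : ℝ) ^ 3 * ∑ l ∈ s, a l ^ 4 := by
  have h1 := sq_sum_le_card_mul_sum_sq (s := s) (f := a)
  have h2 := sq_sum_le_card_mul_sum_sq (s := s) (f := fun l => a l ^ 2)
  have hc : (0 : ℝ) ≤ s.card := Nat.cast_nonneg _
  calc (∑ l ∈ s, a l) ^ 4 = ((∑ l ∈ s, a l) ^ 2) ^ 2 := by ring
    _ ≤ (s.card * ∑ l ∈ s, a l ^ 2) ^ 2 := pow_le_pow_left₀ (sq_nonneg _) h1 2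
    _ = (s.card : ℝ) ^ 2 * (∑ l ∈ s, a l ^ 2) ^ 2 := by ring
    _ ≤ (s.card : ℝ) ^ 2 * (s.card * ∑ l ∈ s, (a l ^ 2) ^ 2) := by gcongr
    _ = _ := by
      simp only [← pow_mul]
      ring

lemma sum_pow_sub_le {r : ℝ} (hr : 2 ≤ r) (p : ℕ) :
    ∑ l ∈ Finset.range p, r ^ (p - l) ≤ 2 * r ^ p := by
  induction p with
  | zero => simp
  | succ p ih =>
    rw [Finset.sum_range_succ']
    simp only [Nat.add_sub_add_right, tsub_zero]
    have : 0 ≤ r ^ p := by positivity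
    rw [pow_succ]
    nlinarith

variable {Ω : Type*} [MeasurableSpace Ω] {Pr : Measure Ω} [IsProbabilityMeasure Pr]
  {X : Word → Ω → (Fin d → ℝ)} {ν : Measure (Fin d → ℝ)}

omit [IsProbabilityMeasure μm] in
/-- Fourth conditional moments of the increments, bounded by moments of the chain. -/
lemma IsBMC.condExp_Dni_pow_four_le (hB : IsBMC Pr X ν P) {f : ℕ → ℕ → (Fin d → ℝ) → ℝ}
    {p : ℕ → ℕ} {n : ℕ} (hg : ∀ l, Measurable (tilde μm (f n l)))
    (hgb : ∀ l, ∃ C, ∀ x, |tilde μm (f n l) x| ≤ C) (i : Word) :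
    Pr[fun ω => Dni Pr X μm f p n i ω ^ 4 | Fsig X i] ≤ᵐ[Pr] fun ω =>
      8 * (p n : ℝ) ^ 3 / 4 ^ n * ∑ l ∈ Finset.range (p n),
        (mom P (tilde μm (f n l)) (p n - l) 4 (X i ω)
          + mom P (tilde μm (f n l)) (p n - l) 1 (X i ω) ^ 4) := by
  have hle := Fsig_le hB.meas i
  set c : ℝ := (Real.sqrt (2 ^ n))⁻¹ with hc
  have hc4 : c ^ 4 = 1 / 4 ^ n := by
    have : Real.sqrt (2 ^ n) ^ 2 = 2 ^ n := Real.sq_sqrt (by positivity)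
    rw [hc, inv_pow, show 4 = 2 * 2 from rfl, pow_mul, this, ← pow_mul, mul_comm n 2, pow_mul]
    norm_num
  set Y : ℕ → Ω → ℝ := fun l => subSum X i (p n - l) (tilde μm (f n l)) with hY
  set m : ℕ → Ω → ℝ := fun l ω => mom P (tilde μm (f n l)) (p n - l) 1 (X i ω) with hm
  have hYm : ∀ l, Measurable (Y l) := fun l => measurable_subSum (fun w => hB.meas _) (hg l) _
  have hYb : ∀ l, ∃ C, ∀ ω, |Y l ω| ≤ C := fun l => exists_bound_subSum X (hgb l) i _
  have hmF : ∀ l, Measurable[Fsig X i] (m l) := fun l =>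
    (measurable_mom (hg l) _ _).comp (measurable_Fsig X (Or.inl (List.prefix_refl i)))
  have hmm : ∀ l, Measurable (m l) := fun l => (hmF l).mono hle le_rfl
  have hmb : ∀ l, ∃ C, ∀ ω, |m l ω| ≤ C := fun l =>
    (exists_bound_mom (hgb l) _ _).imp fun C hC ω => hC _
  have hcond : ∀ l j, Pr[fun ω => Y l ω ^ j | Fsig X i] =ᵐ[Pr]
      fun ω => mom P (tilde μm (f n l)) (p n - l) j (X i ω) := fun l j =>
    hB.condExp_subSum_pow_Fsig (hg l) (hgb l) _ j i
  have hN : Nni X μm f p n i = c • ∑ l ∈ Finset.range (p n + 1), Y l := by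
    funext ω
    simp only [Pi.smul_apply, Finset.sum_apply, smul_eq_mul]
    rfl
  have hEN : Pr[Nni X μm f p n i | Fsig X i] =ᵐ[Pr] c • ∑ l ∈ Finset.range (p n + 1), m l := by
    rw [hN]
    refine (condExp_smul _ _ _).trans (EventuallyEq.const_smul ?_ c)
    refine (condExp_finsetSum (fun l _ => integrable_of_exists_bound (hYm l) (hYb l)) _).trans ?_
    refine eventuallyEq_sum fun l _ => ?_
    have := hcond l 1
    simp only [pow_one] at this
    exact this
  have hlast : m (p n) = Y (p n) := by
    funext ω
    simp [hm, hY, subSum_zero, mom]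
  have hD : Dni Pr X μm f p n i =ᵐ[Pr] fun ω => c * ∑ l ∈ Finset.range (p n), (Y l ω - m l ω) := by
    filter_upwards [hEN] with ω hω
    rw [Dni, hω, hN]
    simp only [Pi.smul_apply, Finset.sum_apply, smul_eq_mul]
    simp only [Finset.sum_range_succ, hlast, Finset.sum_sub_distrib]
    ring
  set W : Ω → ℝ := fun ω => (c * ∑ l ∈ Finset.range (p n), (Y l ω - m l ω)) ^ 4 with hW
  set K : ℝ := 8 * (p n : ℝ) ^ 3 / 4 ^ n with hK
  set V : Ω → ℝ := K • ∑ l ∈ Finset.range (p n), ((fun ω => Y l ω ^ 4) + fun ω => m l ω ^ 4)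
    with hV
  have hWm : Measurable W := (measurable_const.mul (Finset.measurable_sum _ fun l _ =>
    (hYm l).sub (hmm l))).pow_const 4
  have hWb : ∃ C, ∀ ω, |W ω| ≤ C :=
    exists_bound_pow (exists_bound_mul ⟨_, fun _ => le_rfl⟩ (exists_bound_sum _ fun l => by
      obtain ⟨C, hC⟩ := hYb l
      obtain ⟨D, hD⟩ := hmb l
      exact ⟨C + D, fun ω => (abs_sub _ _).trans (add_le_add (hC ω) (hD ω))⟩)) 4
  have hYi : ∀ l, Integrable (fun ω => Y l ω ^ 4) Pr := fun l =>
    integrable_of_exists_bound ((hYm l).pow_const 4) (exists_bound_pow (hYb l) 4)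
  have hmi : ∀ l, Integrable (fun ω => m l ω ^ 4) Pr := fun l =>
    integrable_of_exists_bound ((hmm l).pow_const 4) (exists_bound_pow (hmb l) 4)
  have hVi : Integrable V Pr :=
    (integrable_finsetSum' _ fun l _ => (hYi l).add (hmi l)).smul K
  have hWV : ∀ ω, W ω ≤ V ω := fun ω => by
    simp only [hW, hV, Pi.smul_apply, Finset.sum_apply, Pi.add_apply, smul_eq_mul, mul_pow, hc4]
    have h1 := sum_pow_four_le (Finset.range (p n)) (fun l => Y l ω - m l ω)
    rw [Finset.card_range] at h1
    have h2 : ∑ l ∈ Finset.range (p n), (Y l ω - m l ω) ^ 4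
        ≤ 8 * ∑ l ∈ Finset.range (p n), (Y l ω ^ 4 + m l ω ^ 4) := by
      rw [Finset.mul_sum]
      refine Finset.sum_le_sum fun l _ => ?_
      have h3 : (Y l ω - m l ω) ^ 2 ≤ 2 * (Y l ω ^ 2 + m l ω ^ 2) := by
        nlinarith [sq_nonneg (Y l ω + m l ω)]
      have h4 := pow_le_pow_left₀ (sq_nonneg _) h3 2
      nlinarith [sq_nonneg (Y l ω ^ 2 - m l ω ^ 2)]
    calc 1 / 4 ^ n * (∑ l ∈ Finset.range (p n), (Y l ω - m l ω)) ^ 4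
        ≤ 1 / 4 ^ n * ((p n : ℝ) ^ 3 *
          (8 * ∑ l ∈ Finset.range (p n), (Y l ω ^ 4 + m l ω ^ 4))) := by
          gcongr
          exact h1.trans (by gcongr)
      _ = _ := by rw [hK]; ring
  have hDW : (fun ω => Dni Pr X μm f p n i ω ^ 4) =ᵐ[Pr] W := by
    filter_upwards [hD] with ω hω
    rw [hω]
  have hVc : Pr[V | Fsig X i] =ᵐ[Pr] K • ∑ l ∈ Finset.range (p n),
      ((fun ω => mom P (tilde μm (f n l)) (p n - l) 4 (X i ω)) + fun ω => m l ω ^ 4) := by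
    refine (condExp_smul _ _ _).trans (EventuallyEq.const_smul ?_ K)
    refine (condExp_finsetSum (fun l _ => (hYi l).add (hmi l)) _).trans ?_
    refine eventuallyEq_sum fun l _ => ?_
    refine (condExp_add (hYi l) (hmi l) _).trans ((hcond l 4).add ?_)
    rw [condExp_of_stronglyMeasurable hle ((hmF l).pow_const 4).stronglyMeasurable (hmi l)]
  filter_upwards [condExp_congr_ae hDW,
    condExp_mono (m := Fsig X i) (integrable_of_exists_bound hWm hWb) hVi
      (Eventually.of_forall hWV), hVc] with ω h1 h2 h3
  rw [h1]
  refine h2.trans (le_of_eq ?_)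
  rw [h3]
  simp [hm]

end Increments

section Lyapunov

variable {P : Kernel (Fin d → ℝ) ((Fin d → ℝ) × (Fin d → ℝ))} [IsMarkovKernel P]
  {μm : Measure (Fin d → ℝ)} [IsProbabilityMeasure μm]

omit [IsMarkovKernel P] [IsProbabilityMeasure μm] in
lemma FnAssump.exists_bound {γ σ2 : ℝ} {f : ℕ → ℕ → (Fin d → ℝ) → ℝ}
    (hf : FnAssump P μm γ f σ2) (n l : ℕ) : ∃ C, ∀ x, |f n l x| ≤ C := by
  obtain ⟨-, h0, ⟨C, hC⟩, -⟩ := hf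
  rcases lt_or_ge n l with h | h
  · exact ⟨0, fun x => by simp [h0 n l h]⟩
  · refine ⟨C / bandwidth γ n ^ ((d : ℝ) / 2), fun x => ?_⟩
    rw [le_div_iff₀' (Real.rpow_pos_of_pos (bandwidth_pos γ n) _)]
    exact (hC n l h).1 x

omit [IsMarkovKernel P] [IsProbabilityMeasure μm] in
lemma exists_bound_tilde {g : (Fin d → ℝ) → ℝ} (hg : ∃ C, ∀ x, |g x| ≤ C) :
    ∃ C, ∀ x, |tilde μm g x| ≤ C := by
  obtain ⟨C, hC⟩ := hg
  exact ⟨C + |∫ y, g y ∂μm|, fun x => (abs_sub _ _).trans (add_le_add (hC x) le_rfl)⟩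

omit [IsProbabilityMeasure μm] in
/-- Uniform bounds for the centered functions. -/
lemma FnAssump.exists_tilde_bound {γ σ2 : ℝ} (hγ : 0 ≤ γ) {f : ℕ → ℕ → (Fin d → ℝ) → ℝ}
    (hf : FnAssump P μm γ f σ2) : ∃ C, 0 ≤ C ∧ ∀ n, ∀ l ≤ n,
      (∀ x, bandwidth γ n ^ ((d : ℝ) / 2) * |tilde μm (f n l) x| ≤ C) ∧
      (∀ x, |Qop P (tilde μm (f n l)) x| ≤ C * bandwidth γ n ^ ((d : ℝ) / 2)) ∧
      ∀ x, Qop P (fun y => tilde μm (f n l) y ^ 2) x ≤ C := by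
  have hfb := hf.exists_bound
  obtain ⟨hm, -, ⟨C₁, h₁⟩, ⟨C₂, h₂⟩, -⟩ := hf
  refine ⟨2 * |C₁| + |C₂| + 2 * C₂ ^ 2, by positivity, fun n l hl => ?_⟩
  obtain ⟨ha, hb, hc, -⟩ := h₁ n l hl
  set η := bandwidth γ n ^ ((d : ℝ) / 2) with hη
  have hη0 : 0 < η := Real.rpow_pos_of_pos (bandwidth_pos γ n) _
  have hη1 : η ≤ 1 :=
    Real.rpow_le_one (bandwidth_pos γ n).le (bandwidth_le_one hγ n) (by positivity)
  have hi : |∫ y, f n l y ∂μm| ≤ |C₂| * η :=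
    (abs_integral_le_integral_abs.trans (h₂ n l hl).1).trans
      (mul_le_mul_of_nonneg_right (le_abs_self _) hη0.le)
  have hi1 : |∫ y, f n l y ∂μm| ≤ |C₂| :=
    hi.trans (mul_le_of_le_one_right (abs_nonneg _) hη1)
  have hC₁ := le_abs_self C₁
  have hC₁' := abs_nonneg C₁
  have hC₂' := abs_nonneg C₂
  have hC₂s := sq_nonneg C₂
  refine ⟨fun x => ?_, fun x => ?_, fun x => ?_⟩
  · have h : |tilde μm (f n l) x| ≤ |f n l x| + |∫ y, f n l y ∂μm| := abs_sub _ _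
    have h' := mul_le_mul_of_nonneg_left h hη0.le
    have h'' : η * |∫ y, f n l y ∂μm| ≤ |C₂| :=
      (mul_le_of_le_one_left (abs_nonneg _) hη1).trans hi1
    linarith [ha x]
  · rw [Qop_tilde (hm n l) (hfb n l)]
    have h := abs_sub (Qop P (f n l) x) (∫ y, f n l y ∂μm)
    have h' := hb x
    have : C₁ * η ≤ |C₁| * η := mul_le_mul_of_nonneg_right hC₁ hη0.le
    nlinarith [mul_nonneg hC₁' hη0.le, mul_nonneg hC₂s hη0.le]
  · have h := Qop_tilde_sq_le (P := P) (μm := μm) (hm n l) (hfb n l) x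
    have h' := (le_abs_self _).trans (hc x)
    have h'' : (∫ y, f n l y ∂μm) ^ 2 ≤ C₂ ^ 2 := by
      rw [← sq_abs, ← sq_abs C₂]
      exact pow_le_pow_left₀ (abs_nonneg _) hi1 2
    linarith

variable {Ω : Type*} [MeasurableSpace Ω] {Pr : Measure Ω} [IsProbabilityMeasure Pr]
  {X : Word → Ω → (Fin d → ℝ)} {ν : Measure (Fin d → ℝ)}

/-- Almost sure bound on the sum of the conditional fourth moments of the increments. -/
lemma IsBMC.exists_sum_condExp_Dni_le (hd : 1 ≤ d) (hB : IsBMC Pr X ν P)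
    (hinv : IsInvariantQ P μm) {M α : ℝ} (hM : 0 < M) (hα0 : 0 < α) (hα1 : α < 1)
    (herg : ErgodicQ P μm M α) {γ : ℝ} (hγ0 : 0 < γ) (hγd : γ < 1 / (d : ℝ))
    {f : ℕ → ℕ → (Fin d → ℝ) → ℝ} {σ2 : ℝ} (hf : FnAssump P μm γ f σ2)
    (hα2 : 1 / 2 < α →
      Tendsto (fun n : ℕ => ((2 : ℝ) ^ (1 - (d : ℝ) * γ) * α) ^ n) atTop (nhds 0))
    (p : ℕ → ℕ) :
    ∃ D : ℝ, 0 ≤ D ∧ ∀ n, p n ≤ n → ∀ᵐ ω ∂Pr,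
      ∑ i ∈ gen (n - p n), (Pr[(fun ω' => (Dni Pr X μm f p n i ω') ^ 4) | Fsig X i]) ω
        ≤ D * (p n : ℝ) ^ 3 *
          ((2 ^ n * bandwidth γ n ^ (d : ℝ))⁻¹ + (2 ^ (n - p n))⁻¹) := by
  obtain ⟨κ, hκ1, hκ2, hακ, hκγ⟩ := exists_rate hd hα1 hγ0 hγd hα2
  obtain ⟨C, hC0, hC⟩ := hf.exists_tilde_bound hγ0.le
  obtain ⟨D, hD0, hD⟩ := exists_mom_bound (d := d) M C κ hM hC0 hκ1 hκ2
  have herg' := herg.mono hM.le hα0.le hακ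
  refine ⟨16 * D, by positivity, fun n hpn => ?_⟩
  set η := bandwidth γ n ^ ((d : ℝ) / 2) with hη
  have hη0 : 0 < η := Real.rpow_pos_of_pos (bandwidth_pos γ n) _
  have hη2 : η ^ 2 = bandwidth γ n ^ (d : ℝ) := bandwidth_rpow_half_sq γ n d
  have hκη : κ ^ n * η ^ 2 ≤ 1 := by
    rw [hη2, bandwidth_rpow_dim, ← mul_pow]
    exact pow_le_one₀ (by positivity) hκγ
  have hg : ∀ l, Measurable (tilde μm (f n l)) := fun l => measurable_tilde (hf.1 n l)
  have hgb : ∀ l, ∃ C, ∀ x, |tilde μm (f n l) x| ≤ C := fun l =>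
    exists_bound_tilde (hf.exists_bound n l)
  have hmom : ∀ l ∈ Finset.range (p n), ∀ x, mom P (tilde μm (f n l)) (p n - l) 4 x
      + mom P (tilde μm (f n l)) (p n - l) 1 x ^ 4
      ≤ D * (2 ^ (p n - l) / η ^ 2 + 4 ^ (p n - l)) := fun l hl x => by
    have hl' := Finset.mem_range.1 hl
    obtain ⟨ha, hb, hc⟩ := hC n l (by omega)
    exact hD P μm _ η n hinv herg' (hg l) (integral_tilde (hf.1 n l) (hf.exists_bound n l)) hη0
      ha hb hc hκη _ (by omega) (by omega) x
  have hsum : ∑ l ∈ Finset.range (p n), D * (2 ^ (p n - l) / η ^ 2 + 4 ^ (p n - l))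
      ≤ D * (2 * 2 ^ p n / η ^ 2 + 2 * 4 ^ p n) := by
    rw [← Finset.mul_sum, Finset.sum_add_distrib, ← Finset.sum_div]
    gcongr
    · exact sum_pow_sub_le le_rfl _
    · exact sum_pow_sub_le (by norm_num) _
  have hae : ∀ᵐ ω ∂Pr, ∀ i ∈ gen (n - p n), (Pr[fun ω' => Dni Pr X μm f p n i ω' ^ 4 | Fsig X i]) ω
      ≤ 8 * (p n : ℝ) ^ 3 / 4 ^ n * (D * (2 * 2 ^ p n / η ^ 2 + 2 * 4 ^ p n)) := by
    rw [Filter.eventually_all_finset]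
    intro i _
    filter_upwards [hB.condExp_Dni_pow_four_le (p := p) hg hgb i] with ω hω
    refine hω.trans ?_
    gcongr
    exact (Finset.sum_le_sum fun l hl => hmom l hl _).trans hsum
  filter_upwards [hae] with ω hω
  refine (Finset.sum_le_card_nsmul _ _ _ hω).trans (le_of_eq ?_)
  obtain ⟨k, hk⟩ := Nat.exists_eq_add_of_le hpn
  have h4 : ∀ m : ℕ, (4 : ℝ) ^ m = 2 ^ m * 2 ^ m := fun m => by rw [← mul_pow]; norm_num
  rw [card_gen, nsmul_eq_mul, ← hη2, show n - p n = k by omega]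
  generalize p n = q at hk
  subst hk
  simp only [h4, pow_add, Nat.cast_pow, Nat.cast_ofNat]
  field_simp
  ring

end Lyapunov

/-- Lemma 5.8: fourth-order exponential moment (Lyapunov) condition. -/
theorem fourth_moment_lyapunov
    {d : ℕ} (hd : 1 ≤ d)
    {Ω : Type*} [MeasurableSpace Ω] (Pr : Measure Ω) [IsProbabilityMeasure Pr]
    (X : Word → Ω → (Fin d → ℝ)) (ν : Measure (Fin d → ℝ)) [IsProbabilityMeasure ν]
    (P : Kernel (Fin d → ℝ) ((Fin d → ℝ) × (Fin d → ℝ))) [IsMarkovKernel P]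
    (hBMC : IsBMC Pr X ν P)
    (μm : Measure (Fin d → ℝ)) [IsProbabilityMeasure μm] (hinv : IsInvariantQ P μm)
    (M α : ℝ) (hM : 0 < M) (hα0 : 0 < α) (hα1 : α < 1) (herg : ErgodicQ P μm M α)
    (γ : ℝ) (hγ0 : 0 < γ) (hγd : γ < 1 / (d : ℝ))
    (f : ℕ → ℕ → (Fin d → ℝ) → ℝ) (σ2 : ℝ) (hf : FnAssump P μm γ f σ2)
    (hα2 : 1 / 2 < α →
      Tendsto (fun n : ℕ => ((2 : ℝ) ^ (1 - (d : ℝ) * γ) * α) ^ n) atTop (nhds 0))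
    (s : ℝ) (hs : 0 < s) (b : ℕ → ℝ) (hb : SpeedCond b γ s d)
    (p : ℕ → ℕ) (hp : PCond p b) :
    ∀ δ > (0 : ℝ),
      Filter.limsup
        (fun n => (((b n ^ 2)⁻¹ : ℝ) : EReal) *
          ENNReal.log (Pr {ω |
            b n ^ 2 * ∑ i ∈ gen (n - p n),
              (Pr[(fun ω' => (Dni Pr X μm f p n i ω') ^ 4) | Fsig X i]) ω > δ}))
        atTop = ⊥ := by
  intro δ hδ
  obtain ⟨D, hD0, hD⟩ :=
    hBMC.exists_sum_condExp_Dni_le hd hinv hM hα0 hα1 herg hγ0 hγd hf hα2 p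
  obtain ⟨hb0, -, hb2, -⟩ := hb
  obtain ⟨-, -, hpn, hp0⟩ := hp
  have hR : Tendsto (fun n : ℕ => D * (((n : ℝ) ^ (3 / 2 : ℝ) * b n /
      Real.sqrt (2 ^ n * bandwidth γ n ^ (d : ℝ))) ^ 2 +
      (p n : ℝ) ^ 3 * b n ^ 2 / 2 ^ (n - p n : ℕ))) atTop (nhds 0) := by
    simpa using ((hb2.pow 2).add hp0).const_mul D
  have hev : ∀ᶠ n : ℕ in atTop, (((b n ^ 2)⁻¹ : ℝ) : EReal) *
      ENNReal.log (Pr {ω |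
        b n ^ 2 * ∑ i ∈ gen (n - p n),
          (Pr[(fun ω' => (Dni Pr X μm f p n i ω') ^ 4) | Fsig X i]) ω > δ}) = ⊥ := by
    filter_upwards [hR.eventually_lt_const hδ, eventually_ge_atTop 1] with n hn hn1
    have hnull : Pr {ω | b n ^ 2 * ∑ i ∈ gen (n - p n),
        (Pr[(fun ω' => (Dni Pr X μm f p n i ω') ^ 4) | Fsig X i]) ω > δ} = 0 := by
      have hle : ∀ᵐ ω ∂Pr, b n ^ 2 * ∑ i ∈ gen (n - p n),
          (Pr[(fun ω' => (Dni Pr X μm f p n i ω') ^ 4) | Fsig X i]) ω ≤ δ := by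
        filter_upwards [hD n (hpn n hn1)] with ω hω
        have hbw : 0 < bandwidth γ n ^ (d : ℝ) := Real.rpow_pos_of_pos (bandwidth_pos γ n) _
        have hcast : (p n : ℝ) ≤ n := by exact_mod_cast hpn n hn1
        have hn3 : ((n : ℝ) ^ (3 / 2 : ℝ)) ^ 2 = (n : ℝ) ^ 3 := by
          rw [← Real.rpow_natCast, ← Real.rpow_mul (Nat.cast_nonneg n),
            ← Real.rpow_natCast _ 3]
          norm_num
        rw [div_pow, mul_pow, hn3, Real.sq_sqrt (by positivity)] at hn
        calc _ ≤ b n ^ 2 * (D * (p n : ℝ) ^ 3 *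
              ((2 ^ n * bandwidth γ n ^ (d : ℝ))⁻¹ + (2 ^ (n - p n))⁻¹)) := by gcongr
          _ = D * ((p n : ℝ) ^ 3 * b n ^ 2 / (2 ^ n * bandwidth γ n ^ (d : ℝ)) +
              (p n : ℝ) ^ 3 * b n ^ 2 / 2 ^ (n - p n : ℕ)) := by ring
          _ ≤ D * ((n : ℝ) ^ 3 * b n ^ 2 / (2 ^ n * bandwidth γ n ^ (d : ℝ)) +
              (p n : ℝ) ^ 3 * b n ^ 2 / 2 ^ (n - p n : ℕ)) := by gcongr
          _ ≤ δ := hn.le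
      simpa [ae_iff] using hle
    rw [hnull, ENNReal.log_zero]
    exact EReal.coe_mul_bot_of_pos (inv_pos.2 (pow_pos (hb0 n) 2))
  rw [limsup_congr hev, limsup_const]

end BMC
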